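/- arXiv:1911.13167 — 4 statements merged into one kernel-verified Lean document; each statement's English description precedes it below -/
import Mathlib

section
/- The Gibbs function G is infinitely differentiable and strictly convex on ℝ, and its second derivative satisfies β/c₂ ≤ G''(τ) ≤ β/c₁ for every τ ∈ ℝ. (Equivalently, the variance of the coordinate r under λ_{β,τ} lies between 1/(βc₂) and 1/(βc₁) for every τ.) -/
open MeasureTheory Real Set

/-- The canonical Gibbs function `G(τ) = log ∫ exp(-βV(r) + βτr) dr`. -/
noncomputable def gibbsG (β : ℝ) (V : ℝ → ℝ) (τ : ℝ) : ℝ :=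
  Real.log (∫ r : ℝ, Real.exp (-β * V r + β * τ * r))

open ProbabilityTheory

/-- A function whose derivative lies in `[a, b]` has difference quotients in `[a, b]`. -/
lemma sub_mul_sub_mem_Icc_of_deriv_mem_Icc {f : ℝ → ℝ} {a b : ℝ} (hf : Differentiable ℝ f)
    (hf' : ∀ x, deriv f x ∈ Icc a b) (x y : ℝ) :
    (x - y) * (f x - f y) ∈ Icc (a * (x - y) ^ 2) (b * (x - y) ^ 2) := by
  have key : ∀ u v, u ≤ v → a * (v - u) ≤ f v - f u ∧ f v - f u ≤ b * (v - u) := fun u v huv ↦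
    ⟨mul_sub_le_image_sub_of_le_deriv hf (fun z ↦ (hf' z).1) huv,
      image_sub_le_mul_sub_of_deriv_le hf (fun z ↦ (hf' z).2) huv⟩
  rcases le_total y x with h | h
  · obtain ⟨h₁, h₂⟩ := key y x h
    constructor <;> nlinarith [sub_nonneg.2 h]
  · obtain ⟨h₁, h₂⟩ := key x y h
    constructor <;> nlinarith [sub_nonneg.2 h]

/-- Quadratic lower bound for a function whose second derivative is at least `a`. -/
lemma add_deriv_mul_add_sq_le {W : ℝ → ℝ} {a : ℝ} (hW : ContDiff ℝ 2 W)
    (hW' : ∀ r, a ≤ deriv (deriv W) r) (r : ℝ) :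
    W 0 + deriv W 0 * r + a / 2 * r ^ 2 ≤ W r := by
  have hd : Differentiable ℝ W := hW.differentiable (by norm_num)
  have hd' : Differentiable ℝ (deriv W) :=
    (hW.deriv' (n := 1)).differentiable (by norm_num)
  have hder : ∀ x, HasDerivAt (fun x ↦ W x - a / 2 * x ^ 2) (deriv W x - a * x) x := fun x ↦
    ((hd x).hasDerivAt.sub ((hasDerivAt_pow 2 x).const_mul (a / 2))).congr_deriv (by
      push_cast; ring)
  have hmono : Monotone (deriv fun x ↦ W x - a / 2 * x ^ 2) := by
    intro x y hxy
    rw [(hder x).deriv, (hder y).deriv]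
    linarith [mul_sub_le_image_sub_of_le_deriv hd' hW' hxy]
  have hconv : ConvexOn ℝ univ (fun x ↦ W x - a / 2 * x ^ 2) :=
    hmono.convexOn_univ_of_deriv fun x ↦ (hder x).differentiableAt
  rcases lt_trichotomy r 0 with h | rfl | h
  · have := hconv.slope_le_of_hasDerivAt (mem_univ r) (mem_univ 0) h (hder 0)
    rw [slope_def_field, div_le_iff₀ (by linarith)] at this
    linarith
  · simp
  · have := hconv.le_slope_of_hasDerivAt (mem_univ 0) (mem_univ r) h (hder 0)
    rw [slope_def_field, le_div_iff₀ (by linarith)] at this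
    linarith

/-- The unnormalized Gibbs measure with density `exp (-W)`. -/
noncomputable def gibbsMeasure (W : ℝ → ℝ) : Measure ℝ :=
  volume.withDensity fun r ↦ ENNReal.ofReal (exp (-W r))

lemma integral_gibbsMeasure {W : ℝ → ℝ} (hW : Continuous W) (g : ℝ → ℝ) :
    ∫ r, g r ∂gibbsMeasure W = ∫ r, exp (-W r) * g r := by
  rw [gibbsMeasure, integral_withDensity_eq_integral_toReal_smul (by fun_prop) (by simp)]
  simp [ENNReal.toReal_ofReal (exp_pos _).le]

lemma integrable_gibbsMeasure_iff {W : ℝ → ℝ} (hW : Continuous W) {g : ℝ → ℝ} :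
    Integrable g (gibbsMeasure W) ↔ Integrable fun r ↦ exp (-W r) * g r := by
  rw [gibbsMeasure, integrable_withDensity_iff_integrable_smul' (by fun_prop) (by simp)]
  simp [ENNReal.toReal_ofReal (exp_pos _).le]

lemma integrable_exp_neg_mul_sq_add_mul {c : ℝ} (hc : 0 < c) (d : ℝ) :
    Integrable fun r : ℝ ↦ exp (-c * r ^ 2 + d * r) := by
  have h := ((integrable_exp_neg_mul_sq hc).comp_sub_right (d / (2 * c))).const_mul
    (exp (d ^ 2 / (4 * c)))
  refine h.congr (ae_of_all _ fun r ↦ ?_)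
  simp only [← exp_add]
  congr 1
  field_simp
  ring

lemma integrableExpSet_gibbsMeasure {W : ℝ → ℝ} {a : ℝ} (ha : 0 < a) (hW : ContDiff ℝ 2 W)
    (hW' : ∀ r, a ≤ deriv (deriv W) r) : integrableExpSet id (gibbsMeasure W) = univ := by
  refine eq_univ_of_forall fun t ↦ ?_
  have hc : Continuous W := hW.continuous
  rw [integrableExpSet, mem_ofPred_eq, integrable_gibbsMeasure_iff hc]
  refine ((integrable_exp_neg_mul_sq_add_mul (half_pos ha) (t - deriv W 0)).const_mul
    (exp (-W 0))).mono' (by fun_prop) (ae_of_all _ fun r ↦ ?_)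
  rw [← exp_add, ← exp_add, norm_of_nonneg (exp_pos _).le, exp_le_exp, id]
  linarith [add_deriv_mul_add_sq_le hW hW' r]

lemma integrable_sub_pow_mul_exp_gibbsMeasure {W : ℝ → ℝ} {a : ℝ} (ha : 0 < a)
    (hW : ContDiff ℝ 2 W) (hW' : ∀ r, a ≤ deriv (deriv W) r) (t m : ℝ) (n : ℕ) :
    Integrable (fun r ↦ (r - m) ^ n * exp (t * r)) (gibbsMeasure W) := by
  simp_rw [sub_eq_add_neg, add_pow, Finset.sum_mul]
  refine integrable_finsetSum _ fun i _ ↦ ?_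
  have h := integrable_pow_mul_exp_of_mem_interior_integrableExpSet (X := id)
    (μ := gibbsMeasure W) (v := t) (by simp [integrableExpSet_gibbsMeasure ha hW hW']) i
  refine (h.const_mul ((-m) ^ (n - i) * n.choose i)).congr (ae_of_all _ fun r ↦ ?_)
  simp only [id]
  ring

lemma gibbsMeasure_ne_zero {W : ℝ → ℝ} (hW : Continuous W) : gibbsMeasure W ≠ 0 := by
  intro h
  rw [gibbsMeasure, withDensity_eq_zero_iff (by fun_prop)] at h
  obtain ⟨r, hr⟩ := h.exists
  exact (ENNReal.ofReal_pos.2 (exp_pos _)).ne hr.symm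

/-- Integration by parts: under the tilted Gibbs measure, `W' - t` has covariance `1` with the
coordinate. -/
lemma integral_sub_mul_deriv_sub_mul_exp {W : ℝ → ℝ} {a b : ℝ} (ha : 0 < a) (hW : ContDiff ℝ 2 W)
    (hW' : ∀ r, deriv (deriv W) r ∈ Icc a b) (t m : ℝ) :
    Integrable (fun r ↦ (r - m) * (deriv W r - t) * exp (t * r)) (gibbsMeasure W) ∧
    ∫ r, (r - m) * (deriv W r - t) * exp (t * r) ∂gibbsMeasure W
      = mgf id (gibbsMeasure W) t := by
  have hc : Continuous W := hW.continuous
  have hd : Differentiable ℝ W := hW.differentiable (by norm_num)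
  have hW1 : ContDiff ℝ 1 (deriv W) := hW.deriv'
  have hc' : Continuous (deriv W) := hW1.continuous
  have hmom := integrable_sub_pow_mul_exp_gibbsMeasure ha hW (fun r ↦ (hW' r).1) t m
  have hexp : Integrable (fun r ↦ exp (t * r)) (gibbsMeasure W) := by simpa using hmom 0
  have hlin : Integrable (fun r ↦ (r - m) * exp (t * r)) (gibbsMeasure W) := by simpa using hmom 1
  have hcov : Integrable (fun r ↦ (r - m) * (deriv W r - deriv W m) * exp (t * r))
      (gibbsMeasure W) := by
    refine ((hmom 2).const_mul b).mono' (by fun_prop) (ae_of_all _ fun r ↦ ?_)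
    obtain ⟨h₁, h₂⟩ := sub_mul_sub_mem_Icc_of_deriv_mem_Icc
      (hW1.differentiable (by norm_num)) hW' r m
    rw [norm_of_nonneg (mul_nonneg (le_trans (by positivity) h₁) (exp_pos _).le), ← mul_assoc]
    gcongr
  have hI : Integrable (fun r ↦ (r - m) * (deriv W r - t) * exp (t * r)) (gibbsMeasure W) := by
    refine (hcov.add (hlin.const_mul (deriv W m - t))).congr (ae_of_all _ fun r ↦ ?_)
    simp; ring
  refine ⟨hI, ?_⟩
  have hparts : ∫ r, exp (-W r) * (exp (t * r) - (r - m) * (deriv W r - t) * exp (t * r)) = 0 := by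
    refine integral_eq_zero_of_hasDerivAt_of_integrable
      (f := fun r ↦ exp (-W r) * ((r - m) * exp (t * r))) (fun r ↦ ?_)
      ((integrable_gibbsMeasure_iff hc).1 (hexp.sub hI)) ((integrable_gibbsMeasure_iff hc).1 hlin)
    have h₁ := (hd r).hasDerivAt.neg.exp
    have h₂ := ((hasDerivAt_id r).const_mul t).exp
    refine (h₁.mul (((hasDerivAt_id r).sub_const m).mul h₂)).congr_deriv ?_
    simp only [id, Pi.mul_apply, Pi.neg_apply]
    ring
  rw [← integral_gibbsMeasure hc, integral_sub hexp hI] at hparts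
  simp only [mgf, id]
  linarith

/-- If `a ≤ W'' ≤ b`, the variance of the coordinate under the tilted Gibbs measure lies in
`[1 / b, 1 / a]`. -/
lemma iteratedDeriv_two_cgf_gibbsMeasure_mem_Icc {W : ℝ → ℝ} {a b : ℝ} (ha : 0 < a)
    (hW : ContDiff ℝ 2 W) (hW' : ∀ r, deriv (deriv W) r ∈ Icc a b) (t : ℝ) :
    iteratedDeriv 2 (cgf id (gibbsMeasure W)) t ∈ Icc (1 / b) (1 / a) := by
  have hb : 0 < b := ha.trans_le ((hW' 0).1.trans (hW' 0).2)
  have hW1 : ContDiff ℝ 1 (deriv W) := hW.deriv'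
  have hset := integrableExpSet_gibbsMeasure ha hW fun r ↦ (hW' r).1
  have ht : t ∈ interior (integrableExpSet id (gibbsMeasure W)) := by simp [hset]
  have hZ : 0 < mgf id (gibbsMeasure W) t := mgf_pos' (gibbsMeasure_ne_zero hW.continuous)
    (interior_subset (s := integrableExpSet id (gibbsMeasure W)) ht)
  rw [iteratedDeriv_two_cgf_eq_integral ht]
  set m := deriv (cgf id (gibbsMeasure W)) t with hm
  have hmom := integrable_sub_pow_mul_exp_gibbsMeasure ha hW (fun r ↦ (hW' r).1) t m
  have hexp : Integrable (fun r ↦ exp (t * r)) (gibbsMeasure W) := by simpa using hmom 0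
  have hlin : Integrable (fun r ↦ (r - m) * exp (t * r)) (gibbsMeasure W) := by simpa using hmom 1
  have hcenter : ∫ r, (r - m) * exp (t * r) ∂gibbsMeasure W = 0 := by
    have h : ∫ r, r * exp (t * r) ∂gibbsMeasure W = m * mgf id (gibbsMeasure W) t := by
      rw [hm, deriv_cgf ht, div_mul_cancel₀ _ hZ.ne']
      simp
    have hid : Integrable (fun r ↦ r * exp (t * r)) (gibbsMeasure W) := by
      simpa using integrable_pow_mul_exp_of_mem_interior_integrableExpSet ht 1
    simp_rw [sub_mul]
    rw [integral_sub hid (hexp.const_mul m), integral_const_mul, h]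
    simp [mgf]
  obtain ⟨hI, hparts⟩ := integral_sub_mul_deriv_sub_mul_exp ha hW hW' t m
  have hcov_eq : (fun r ↦ (r - m) * (deriv W r - deriv W m) * exp (t * r)) = fun r ↦
      (r - m) * (deriv W r - t) * exp (t * r) - (deriv W m - t) * ((r - m) * exp (t * r)) := by
    ext r; ring
  have hcov : Integrable (fun r ↦ (r - m) * (deriv W r - deriv W m) * exp (t * r))
      (gibbsMeasure W) := hcov_eq ▸ hI.sub (hlin.const_mul _)
  have hcov_int : ∫ r, (r - m) * (deriv W r - deriv W m) * exp (t * r) ∂gibbsMeasure W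
      = mgf id (gibbsMeasure W) t := by
    rw [hcov_eq, integral_sub hI (hlin.const_mul _), integral_const_mul, hcenter, hparts]
    simp
  have hbound (r : ℝ) := sub_mul_sub_mem_Icc_of_deriv_mem_Icc
    (hW1.differentiable (by norm_num)) hW' r m
  have hlow : a * ∫ r, (r - m) ^ 2 * exp (t * r) ∂gibbsMeasure W
      ≤ mgf id (gibbsMeasure W) t := by
    rw [← hcov_int, ← integral_const_mul]
    refine integral_mono ((hmom 2).const_mul a) hcov fun r ↦ ?_
    dsimp only
    rw [← mul_assoc]
    exact mul_le_mul_of_nonneg_right (hbound r).1 (exp_pos _).le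
  have hupp : mgf id (gibbsMeasure W) t
      ≤ b * ∫ r, (r - m) ^ 2 * exp (t * r) ∂gibbsMeasure W := by
    rw [← hcov_int, ← integral_const_mul]
    refine integral_mono hcov ((hmom 2).const_mul b) fun r ↦ ?_
    dsimp only
    rw [← mul_assoc]
    exact mul_le_mul_of_nonneg_right (hbound r).2 (exp_pos _).le
  simp only [id]
  constructor
  · rw [div_le_div_iff₀ hb hZ]
    linarith
  · rw [div_le_div_iff₀ hZ ha]
    linarith

lemma gibbsG_eq_cgf (β : ℝ) {V : ℝ → ℝ} (hV : Continuous V) :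
    gibbsG β V = fun τ ↦ cgf id (gibbsMeasure fun r ↦ β * V r) (β * τ) := by
  ext τ
  rw [gibbsG, cgf, mgf, integral_gibbsMeasure (by fun_prop)]
  simp only [← exp_add, id, neg_mul]

/-- The Gibbs function `G` is infinitely differentiable and strictly
convex on `ℝ`, and its second derivative satisfies `β/c₂ ≤ G''(τ) ≤ β/c₁` for all `τ`. -/
theorem gibbsG_smooth_strictConvex_secondDeriv_bounds
    (β c₁ c₂ : ℝ) (V : ℝ → ℝ)
    (hβ : 0 < β) (hc₁ : 0 < c₁) (hc₁₂ : c₁ ≤ c₂)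
    (hV : ContDiff ℝ 2 V)
    (hV'' : ∀ r : ℝ, c₁ ≤ deriv (deriv V) r ∧ deriv (deriv V) r ≤ c₂) :
    ContDiff ℝ (⊤ : ℕ∞) (gibbsG β V) ∧
    StrictConvexOn ℝ Set.univ (gibbsG β V) ∧
    ∀ τ : ℝ, β / c₂ ≤ deriv (deriv (gibbsG β V)) τ ∧
      deriv (deriv (gibbsG β V)) τ ≤ β / c₁ := by
  have hc₂ : 0 < c₂ := hc₁.trans_le hc₁₂
  have hW : ContDiff ℝ 2 fun r ↦ β * V r := contDiff_const.mul hV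
  have hW' (r : ℝ) : deriv (deriv fun r ↦ β * V r) r ∈ Icc (β * c₁) (β * c₂) := by
    have h : (deriv fun r ↦ β * V r) = fun r ↦ β * deriv V r := by
      ext r; exact deriv_const_mul_field β
    rw [h, deriv_const_mul_field]
    exact ⟨by gcongr; exact (hV'' r).1, by gcongr; exact (hV'' r).2⟩
  have hset := integrableExpSet_gibbsMeasure (mul_pos hβ hc₁) hW fun r ↦ (hW' r).1
  have hcgf {n : ℕ∞} : ContDiff ℝ n (cgf id (gibbsMeasure fun r ↦ β * V r)) :=
    contDiff_iff_contDiffAt.2 fun t ↦ (analyticAt_cgf (by simp [hset])).contDiffAt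
  have hG := gibbsG_eq_cgf β hV.continuous
  have hsmooth : ContDiff ℝ (⊤ : ℕ∞) (gibbsG β V) := by
    rw [hG]
    exact hcgf.comp (contDiff_const.mul contDiff_id)
  have hbounds (τ : ℝ) : β / c₂ ≤ deriv (deriv (gibbsG β V)) τ ∧
      deriv (deriv (gibbsG β V)) τ ≤ β / c₁ := by
    have h2 : deriv (deriv (gibbsG β V)) τ
        = β ^ 2 * iteratedDeriv 2 (cgf id (gibbsMeasure fun r ↦ β * V r)) (β * τ) := by
      rw [← iteratedDeriv_one (f := gibbsG β V), ← iteratedDeriv_succ, hG,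
        iteratedDeriv_comp_const_mul (by exact_mod_cast hcgf (n := 2))]
    obtain ⟨hl, hu⟩ := iteratedDeriv_two_cgf_gibbsMeasure_mem_Icc (mul_pos hβ hc₁) hW hW' (β * τ)
    rw [h2, show β / c₂ = β ^ 2 * (1 / (β * c₂)) by field_simp,
      show β / c₁ = β ^ 2 * (1 / (β * c₁)) by field_simp]
    exact ⟨by gcongr, by gcongr⟩
  refine ⟨hsmooth, ?_, hbounds⟩
  exact strictConvexOn_of_deriv2_pos' convex_univ hsmooth.continuous.continuousOn
    fun τ _ ↦ (div_pos hβ hc₂).trans_le (hbounds τ).1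
end

section
/- Let (Ω, ℱ, ℙ) be a probability space, T > 0 and N ≥ 3, and for 1 ≤ i ≤ N−2 let A_i : Ω × [0,T] → ℝ be jointly measurable with E[Σ_{i=1}^{N−2} ∫_0^T A_i(t)² dt] < ∞. Let φ : [0,T]×[0,1] → ℝ be continuous and continuously differentiable in the space variable x. Then E[ Σ_{i=1}^{N−2} ∫_0^T | A_i(t) ( φ̄_{i+1}(t) − φ̄_i(t) ) | dt ] ≤ √2 · ( E[ (1/N) Σ_{i=1}^{N−2} ∫_0^T A_i(t)² dt ] )^{1/2} · ( ∫_0^T ∫_0^1 |∂_x φ(t,x)|² dx dt )^{1/2}. -/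
open MeasureTheory Real Set Finset

/-- Local average `φ̄_i(t) = N ∫_{i/N - 1/(2N)}^{i/N + 1/(2N)} φ(t,x) dx`. -/
noncomputable def localAvg (N : ℕ) (φ : ℝ → ℝ → ℝ) (i : ℕ) (t : ℝ) : ℝ :=
  N * ∫ x in Set.Icc ((i : ℝ) / N - 1 / (2 * N)) ((i : ℝ) / N + 1 / (2 * N)), φ t x

/-- Cauchy-Schwarz form of the fundamental theorem of calculus. -/
theorem sq_sub_le_mul_integral_sq_deriv {f f' : ℝ → ℝ} (hf : ∀ x, HasDerivAt f (f' x) x)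
    (hf' : Continuous f') {a b : ℝ} (hab : a ≤ b) :
    (f b - f a) ^ 2 ≤ (b - a) * ∫ x in a..b, f' x ^ 2 := by
  rcases hab.eq_or_lt with rfl | hlt
  · simp
  have hftc : ∫ x in a..b, f' x = f b - f a :=
    intervalIntegral.integral_eq_sub_of_hasDerivAt (fun x _ => hf x) (hf'.intervalIntegrable _ _)
  set m := f b - f a
  have hpos : 0 < b - a := sub_pos.2 hlt
  set c := m / (b - a) with hc
  have hnonneg : 0 ≤ ∫ x in a..b, (f' x - c) ^ 2 :=
    intervalIntegral.integral_nonneg hab fun x _ => sq_nonneg _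
  have hexpand : ∫ x in a..b, (f' x - c) ^ 2
      = (∫ x in a..b, f' x ^ 2) - 2 * c * m + c ^ 2 * (b - a) := by
    have hpt : (fun x => (f' x - c) ^ 2) = fun x => (f' x ^ 2 - 2 * c * f' x) + c ^ 2 := by
      funext x; ring
    rw [hpt, intervalIntegral.integral_add, intervalIntegral.integral_sub,
      intervalIntegral.integral_const_mul, hftc, intervalIntegral.integral_const, smul_eq_mul]
    · ring
    all_goals exact Continuous.intervalIntegrable (by fun_prop) _ _
  have hcm : c * (b - a) = m := by rw [hc]; field_simp
  rw [hexpand] at hnonneg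
  have := mul_nonneg hpos.le hnonneg
  nlinarith

theorem localAvg_eq_intervalIntegral {N : ℕ} (hN : 0 < N) (φ : ℝ → ℝ → ℝ) (i : ℕ) (t : ℝ) :
    localAvg N φ i t
      = N * ∫ x in (((i : ℝ) - 1 / 2) / N)..((((i + 1 : ℕ) : ℝ) - 1 / 2) / N), φ t x := by
  have hN' : (0 : ℝ) < N := by exact_mod_cast hN
  have hl : (i : ℝ) / N - 1 / (2 * N) = ((i : ℝ) - 1 / 2) / N := by field_simp
  have hr : (i : ℝ) / N + 1 / (2 * N) = (((i + 1 : ℕ) : ℝ) - 1 / 2) / N := by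
    push_cast; field_simp; ring
  rw [localAvg, hl, hr, integral_Icc_eq_integral_Ioc, intervalIntegral.integral_of_le]
  push_cast
  gcongr
  linarith

theorem continuous_localAvg {φ : ℝ → ℝ → ℝ} (hφ : Continuous (Function.uncurry φ)) (N i : ℕ) :
    Continuous (localAvg N φ i) :=
  continuous_const.mul (continuous_parametric_integral_of_continuous hφ isCompact_Icc)

theorem sq_localAvg_increment_le {N : ℕ} (hN : 0 < N) {φ φx : ℝ → ℝ → ℝ} (t : ℝ)
    (hφ : ∀ x, HasDerivAt (φ t) (φx t x) x) (hφx : Continuous (φx t)) (i : ℕ) :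
    (localAvg N φ (i + 1) t - localAvg N φ i t) ^ 2
      ≤ 1 / N * ∫ x in (((i : ℝ) - 1 / 2) / N)..((((i + 2 : ℕ) : ℝ) - 1 / 2) / N), φx t x ^ 2 := by
  have hN' : (0 : ℝ) < N := by exact_mod_cast hN
  have hcont : Continuous (φ t) := continuous_iff_continuousAt.2 fun x => (hφ x).continuousAt
  set a : ℝ := ((i : ℝ) - 1 / 2) / N with ha
  have hb : (((i + 1 : ℕ) : ℝ) - 1 / 2) / N = a + 1 / N := by rw [ha]; push_cast; field_simp; ring
  have hc : (((i + 1 + 1 : ℕ) : ℝ) - 1 / 2) / N = a + 1 / N + 1 / N := by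
    rw [ha]; push_cast; field_simp; ring
  have hinv : (0 : ℝ) < 1 / N := by positivity
  set K := 1 / (N : ℝ) * ∫ x in a..(((i + 1 + 1 : ℕ) : ℝ) - 1 / 2) / N, φx t x ^ 2 with hK
  have hbound : ∀ x ∈ Set.uIoc a (a + 1 / N), ‖φ t (x + 1 / N) - φ t x‖ ≤ √K := by
    intro x hx
    rw [Set.uIoc_of_le (by linarith)] at hx
    refine Real.abs_le_sqrt ?_
    refine (sq_sub_le_mul_integral_sq_deriv hφ hφx (by linarith : x ≤ x + 1 / N)).trans ?_
    rw [hK, hc, add_sub_cancel_left]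
    refine mul_le_mul_of_nonneg_left ?_ hinv.le
    refine intervalIntegral.integral_mono_interval hx.1.le (by linarith) (by linarith [hx.2])
      (Filter.Eventually.of_forall fun x => sq_nonneg _)
      (Continuous.intervalIntegrable (by fun_prop) _ _)
  have hdiff : localAvg N φ (i + 1) t - localAvg N φ i t
      = N * ∫ x in a..(a + 1 / N), (φ t (x + 1 / N) - φ t x) := by
    rw [localAvg_eq_intervalIntegral hN, localAvg_eq_intervalIntegral hN, hc, hb,
      intervalIntegral.integral_sub, intervalIntegral.integral_comp_add_right (φ t), mul_sub]
    all_goals exact Continuous.intervalIntegrable (by fun_prop) _ _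
  have hnorm := intervalIntegral.norm_integral_le_of_norm_le_const hbound
  have habs : |localAvg N φ (i + 1) t - localAvg N φ i t| ≤ √K := by
    rw [hdiff, abs_mul, abs_of_pos hN']
    rw [add_sub_cancel_left, abs_of_pos hinv, Real.norm_eq_abs] at hnorm
    calc _ ≤ (N : ℝ) * (√K * (1 / N)) := by gcongr
      _ = √K := by field_simp
  have hK0 : 0 ≤ K := mul_nonneg hinv.le <|
    intervalIntegral.integral_nonneg (by rw [hc]; linarith) fun x _ => sq_nonneg _
  rw [← sq_abs, ← Real.sq_sqrt hK0]
  gcongr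

theorem sum_sq_localAvg_increment_le {N : ℕ} (hN : 3 ≤ N) {φ φx : ℝ → ℝ → ℝ} (t : ℝ)
    (hφ : ∀ x, HasDerivAt (φ t) (φx t x) x) (hφx : Continuous (φx t)) :
    ∑ i ∈ Finset.Icc 1 (N - 2), (localAvg N φ (i + 1) t - localAvg N φ i t) ^ 2
      ≤ 2 / N * ∫ x in Set.Icc (0 : ℝ) 1, φx t x ^ 2 := by
  have hN0 : 0 < N := by omega
  have hN' : (0 : ℝ) < N := by exact_mod_cast hN0
  have hint : ∀ a b : ℝ, IntervalIntegrable (fun x => φx t x ^ 2) volume a b := fun a b =>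
    Continuous.intervalIntegrable (by fun_prop) _ _
  have hmono : ∀ m n : ℕ, 1 ≤ m → m ≤ n → n ≤ N →
      ∫ x in (((m : ℝ) - 1 / 2) / N)..(((n : ℝ) - 1 / 2) / N), φx t x ^ 2
        ≤ ∫ x in (0 : ℝ)..1, φx t x ^ 2 := by
    intro m n hm hmn hn
    have hm' : (1 : ℝ) ≤ m := by exact_mod_cast hm
    have hmn' : (m : ℝ) ≤ n := by exact_mod_cast hmn
    have hn' : (n : ℝ) ≤ N := by exact_mod_cast hn
    refine intervalIntegral.integral_mono_interval (div_nonneg (by linarith) hN'.le)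
      (by gcongr) ((div_le_one hN').2 (by linarith))
      (Filter.Eventually.of_forall fun x => sq_nonneg _) (hint _ _)
  have hadj : ∀ k : ℕ, k ≤ 1 →
      ∑ i ∈ Finset.Ico 1 (N - 1),
        ∫ x in ((((i + k : ℕ) : ℝ) - 1 / 2) / N)..((((i + 1 + k : ℕ) : ℝ) - 1 / 2) / N),
          φx t x ^ 2 ≤ ∫ x in (0 : ℝ)..1, φx t x ^ 2 := by
    intro k hk
    rw [intervalIntegral.sum_integral_adjacent_intervals_Ico
      (a := fun i : ℕ => (((i + k : ℕ) : ℝ) - 1 / 2) / N) (by omega) fun _ _ => hint _ _]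
    exact hmono _ _ (by omega) (by omega) (by omega)
  have hIcc : Finset.Icc 1 (N - 2) = Finset.Ico 1 (N - 1) := by
    ext i; simp only [Finset.mem_Icc, Finset.mem_Ico]; omega
  rw [integral_Icc_eq_integral_Ioc, ← intervalIntegral.integral_of_le zero_le_one, hIcc]
  calc _ ≤ ∑ i ∈ Finset.Ico 1 (N - 1), 1 / (N : ℝ) *
        ∫ x in (((i : ℝ) - 1 / 2) / N)..((((i + 2 : ℕ) : ℝ) - 1 / 2) / N), φx t x ^ 2 :=
        Finset.sum_le_sum fun i _ => sq_localAvg_increment_le hN0 t hφ hφx i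
    _ = 1 / (N : ℝ) * ((∑ i ∈ Finset.Ico 1 (N - 1),
          ∫ x in ((((i + 0 : ℕ) : ℝ) - 1 / 2) / N)..((((i + 1 + 0 : ℕ) : ℝ) - 1 / 2) / N),
            φx t x ^ 2) + ∑ i ∈ Finset.Ico 1 (N - 1),
          ∫ x in ((((i + 1 : ℕ) : ℝ) - 1 / 2) / N)..((((i + 1 + 1 : ℕ) : ℝ) - 1 / 2) / N),
            φx t x ^ 2) := by
        rw [← Finset.mul_sum, ← Finset.sum_add_distrib]
        congr 1
        exact Finset.sum_congr rfl fun i _ =>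
          (intervalIntegral.integral_add_adjacent_intervals (hint _ _) (hint _ _)).symm
    _ ≤ 1 / (N : ℝ) * ((∫ x in (0 : ℝ)..1, φx t x ^ 2) + ∫ x in (0 : ℝ)..1, φx t x ^ 2) := by
        gcongr
        · exact hadj 0 (by omega)
        · exact hadj 1 le_rfl
    _ = _ := by ring

/-- Cauchy-Schwarz for finite sums, in `ℝ≥0∞`-valued form. -/
theorem sum_ofReal_abs_mul_le {ι : Type*} (s : Finset ι) (a d : ι → ℝ) {B : ℝ}
    (hB : ∑ i ∈ s, d i ^ 2 ≤ B) :
    ∑ i ∈ s, ENNReal.ofReal |a i * d i|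
      ≤ (∑ i ∈ s, ENNReal.ofReal (a i ^ 2)) ^ (1 / 2 : ℝ) * ENNReal.ofReal B ^ (1 / 2 : ℝ) := by
  have ha : 0 ≤ ∑ i ∈ s, a i ^ 2 := Finset.sum_nonneg fun i _ => sq_nonneg _
  have hB0 : 0 ≤ B := (Finset.sum_nonneg fun i _ => sq_nonneg (d i)).trans hB
  rw [← ENNReal.ofReal_sum_of_nonneg fun i _ => abs_nonneg _,
    ← ENNReal.ofReal_sum_of_nonneg fun i _ => sq_nonneg _,
    ENNReal.ofReal_rpow_of_nonneg ha (by norm_num),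
    ENNReal.ofReal_rpow_of_nonneg hB0 (by norm_num),
    ← ENNReal.ofReal_mul (by positivity), ← Real.sqrt_eq_rpow, ← Real.sqrt_eq_rpow]
  refine ENNReal.ofReal_le_ofReal ?_
  have hcs := Real.sum_mul_le_sqrt_mul_sqrt s (fun i => |a i|) fun i => |d i|
  simp only [sq_abs] at hcs
  simp only [abs_mul]
  exact hcs.trans (by gcongr)

theorem lintegral_mul_rpow_half_le {α : Type*} [MeasurableSpace α] (μ : Measure α)
    {f g : α → ENNReal} (hf : AEMeasurable f μ) (hg : AEMeasurable g μ) :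
    ∫⁻ x, f x ^ (1 / 2 : ℝ) * g x ^ (1 / 2 : ℝ) ∂μ
      ≤ (∫⁻ x, f x ∂μ) ^ (1 / 2 : ℝ) * (∫⁻ x, g x ∂μ) ^ (1 / 2 : ℝ) := by
  have h := ENNReal.lintegral_mul_le_Lp_mul_Lq μ Real.HolderConjugate.two_two
    (hf.pow_const (1 / 2 : ℝ)) (hg.pow_const (1 / 2 : ℝ))
  have hsq (y : ENNReal) : (y ^ (1 / 2 : ℝ)) ^ (2 : ℝ) = y := by
    rw [← ENNReal.rpow_mul]; norm_num
  simpa only [Pi.mul_apply, hsq] using h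

/-- If the `A_i` are jointly measurable with
`E[Σᵢ ∫₀ᵀ Aᵢ² dt] < ∞` and `φ` is continuous with continuous spatial derivative `∂ₓφ`,
then `E[Σᵢ ∫₀ᵀ |Aᵢ (φ̄ᵢ₊₁ - φ̄ᵢ)| dt] ≤ √2 (E[(1/N)Σᵢ∫Aᵢ²])^{1/2} (∫₀ᵀ∫₀¹ |∂ₓφ|²)^{1/2}`. -/
theorem expectation_localAvg_increment_bound
    {Ω : Type*} [MeasurableSpace Ω] (ℙ : Measure Ω) [IsProbabilityMeasure ℙ]
    (T : ℝ) (hT : 0 < T) (N : ℕ) (hN : 3 ≤ N)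
    (A : ℕ → Ω → ℝ → ℝ)
    (hA : ∀ i, Measurable (Function.uncurry (A i)))
    (hAfin : (∫⁻ ω, (∑ i ∈ Finset.Icc 1 (N - 2),
        ∫⁻ t in Set.Icc (0 : ℝ) T, ENNReal.ofReal ((A i ω t) ^ 2)) ∂ℙ) < ⊤)
    (φ φx : ℝ → ℝ → ℝ)
    (hφ : Continuous (Function.uncurry φ))
    (hφderiv : ∀ t x : ℝ, HasDerivAt (φ t) (φx t x) x)
    (hφx : Continuous (Function.uncurry φx)) :
    (∫⁻ ω, (∑ i ∈ Finset.Icc 1 (N - 2),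
        ∫⁻ t in Set.Icc (0 : ℝ) T,
          ENNReal.ofReal |A i ω t * (localAvg N φ (i + 1) t - localAvg N φ i t)|) ∂ℙ) ≤
      ENNReal.ofReal (Real.sqrt 2) *
        ((∫⁻ ω, (∑ i ∈ Finset.Icc 1 (N - 2),
          ∫⁻ t in Set.Icc (0 : ℝ) T, ENNReal.ofReal ((A i ω t) ^ 2)) ∂ℙ) / N) ^ (1/2 : ℝ) *
        (ENNReal.ofReal
          (∫ t in Set.Icc (0 : ℝ) T, ∫ x in Set.Icc (0 : ℝ) 1, (φx t x) ^ 2)) ^ (1/2 : ℝ) := by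
  have hN' : (0 : ℝ) < N := by exact_mod_cast (by omega : 0 < N)
  set ν := (volume : Measure ℝ).restrict (Set.Icc 0 T)
  set s := Finset.Icc 1 (N - 2)
  set G : ℝ → ℝ := fun t => ∫ x in Set.Icc (0 : ℝ) 1, (φx t x) ^ 2
  have hGcont : Continuous G :=
    continuous_parametric_integral_of_continuous (f := fun t x => φx t x ^ 2)
      (show Continuous fun p : ℝ × ℝ => φx p.1 p.2 ^ 2 from hφx.pow 2) isCompact_Icc
  have hG0 : ∀ t, 0 ≤ G t := fun t => integral_nonneg fun x => sq_nonneg _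
  have hAm : ∀ i, Measurable fun p : Ω × ℝ => A i p.1 p.2 := hA
  have hD : ∀ i, Measurable (localAvg N φ i) := fun i => (continuous_localAvg hφ N i).measurable
  have hiter : ∀ F : ℕ → Ω × ℝ → ENNReal, (∀ i, Measurable (F i)) →
      ∫⁻ ω, ∑ i ∈ s, ∫⁻ t, F i (ω, t) ∂ν ∂ℙ = ∫⁻ p, ∑ i ∈ s, F i p ∂(ℙ.prod ν) := by
    intro F hF
    rw [lintegral_prod _ (Finset.measurable_fun_sum s fun i _ => hF i).aemeasurable]
    refine lintegral_congr fun ω => ?_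
    exact (lintegral_finsetSum s fun i _ => (hF i).comp measurable_prodMk_left).symm
  rw [hiter (fun i p => ENNReal.ofReal
      |A i p.1 p.2 * (localAvg N φ (i + 1) p.2 - localAvg N φ i p.2)|) (fun i => by
        exact ((hAm i).mul (((hD (i + 1)).comp measurable_snd).sub
          ((hD i).comp measurable_snd))).abs.ennreal_ofReal),
    hiter (fun i p => ENNReal.ofReal (A i p.1 p.2 ^ 2))
      (fun i => ((hAm i).pow_const 2).ennreal_ofReal)]
  have hGint : ∫⁻ p : Ω × ℝ, ENNReal.ofReal (2 / N * G p.2) ∂(ℙ.prod ν)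
      = ENNReal.ofReal (2 / N) * ENNReal.ofReal (∫ t, G t ∂ν) := by
    have hm : Measurable fun p : Ω × ℝ => ENNReal.ofReal (2 / N * G p.2) :=
      ((hGcont.measurable.comp measurable_snd).const_mul _).ennreal_ofReal
    rw [lintegral_prod _ hm.aemeasurable]
    simp only
    rw [lintegral_const, measure_univ, mul_one,
      ofReal_integral_eq_lintegral_ofReal
        (hGcont.continuousOn.integrableOn_compact isCompact_Icc)
        (Filter.Eventually.of_forall hG0), ← lintegral_const_mul _ hGcont.measurable.ennreal_ofReal]
    exact lintegral_congr fun t => ENNReal.ofReal_mul (by positivity)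
  calc _ ≤ ∫⁻ p, (∑ i ∈ s, ENNReal.ofReal (A i p.1 p.2 ^ 2)) ^ (1 / 2 : ℝ)
          * ENNReal.ofReal (2 / N * G p.2) ^ (1 / 2 : ℝ) ∂(ℙ.prod ν) :=
        lintegral_mono fun p => sum_ofReal_abs_mul_le s (fun i => A i p.1 p.2) _
          (sum_sq_localAvg_increment_le hN p.2 (hφderiv p.2) (by fun_prop))
    _ ≤ (∫⁻ p, ∑ i ∈ s, ENNReal.ofReal (A i p.1 p.2 ^ 2) ∂(ℙ.prod ν)) ^ (1 / 2 : ℝ)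
          * (∫⁻ p : Ω × ℝ, ENNReal.ofReal (2 / N * G p.2) ∂(ℙ.prod ν)) ^ (1 / 2 : ℝ) :=
        lintegral_mul_rpow_half_le _
          (Finset.measurable_fun_sum s fun i _ =>
            ((hAm i).pow_const 2).ennreal_ofReal).aemeasurable
          ((hGcont.measurable.comp measurable_snd).const_mul _).ennreal_ofReal.aemeasurable
    _ = _ := by
        have h2 : ENNReal.ofReal (√2) = ENNReal.ofReal 2 ^ (1 / 2 : ℝ) := by
          rw [ENNReal.ofReal_rpow_of_nonneg (by norm_num) (by norm_num), Real.sqrt_eq_rpow]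
        have hhalf : (0 : ℝ) ≤ 1 / 2 := by norm_num
        rw [hGint, h2, ENNReal.ofReal_div_of_pos hN', ENNReal.ofReal_natCast]
        rw [← ENNReal.mul_rpow_of_nonneg _ _ hhalf, ← ENNReal.mul_rpow_of_nonneg _ _ hhalf,
          ← ENNReal.mul_rpow_of_nonneg _ _ hhalf]
        congr 1
        simp only [div_eq_mul_inv]
        ring
end

section
/- There exists a constant C, depending only on β and c₂, with the following property (one-and-a-half-block estimate, force version). For all integers N, l, k with 1 ≤ l ≤ k ≤ N−l, and every smooth strictly positive probability density f with respect to λ^N_{β,τ₀}: ∫ ( V̄'_{l,k+l} − V̄'_{l,k} )² f dλ^N_{β,τ₀} ≤ C ( 1/l + l · D̃(f) ), where V̄'_{l,i} := (1/l) Σ_{j=1}^{l} V'(r_{i−j+1}). -/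
open MeasureTheory Real Set Finset
open scoped ENNReal

/-- One-site Gibbs density `exp(-βV(r) + βτr - G(τ))`. -/
noncomputable def gibbsDensity (β : ℝ) (V : ℝ → ℝ) (τ r : ℝ) : ℝ :=
  Real.exp (-β * V r + β * τ * r - gibbsG β V τ)

/-- The `N`-fold product Gibbs measure `λ^N_{β,τ}` on `ℝ^N`. -/
noncomputable def gibbsPi (β : ℝ) (V : ℝ → ℝ) (τ : ℝ) (N : ℕ) : Measure (Fin N → ℝ) :=
  volume.withDensity fun x => ENNReal.ofReal (∏ i, gibbsDensity β V τ (x i))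

/-- The coordinates `r_1, …, r_N` (1-indexed), extended by `0` out of range. -/
noncomputable def coord {N : ℕ} (x : Fin N → ℝ) (n : ℕ) : ℝ :=
  if h : n - 1 < N then x ⟨n - 1, h⟩ else 0

/-- Block average of the forces: `V̄'_{l,i} = (1/l) Σ_{j=1}^{l} V'(r_{i-j+1})`. -/
noncomputable def forceBlockAvg (V : ℝ → ℝ) {N : ℕ} (l i : ℕ) (x : Fin N → ℝ) : ℝ :=
  (1 / (l : ℝ)) * ∑ j ∈ Finset.Icc 1 l, deriv V (coord x (i - j + 1))

/-- The stretch Dirichlet form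
`D̃(f) = Σ_{j=1}^{N-1} ∫ (∂f/∂r_{j+1} - ∂f/∂r_j)²/f dλ^N`. -/
noncomputable def stretchDirichlet (β : ℝ) (V : ℝ → ℝ) (τ : ℝ) (N : ℕ)
    (f : (Fin N → ℝ) → ℝ) : ℝ≥0∞ :=
  ∑ j : Fin (N - 1),
    ∫⁻ x, ENNReal.ofReal
      ((fderiv ℝ f x (Pi.single (⟨j.1 + 1, by have := j.isLt; omega⟩ : Fin N) 1) -
        fderiv ℝ f x (Pi.single (⟨j.1, by have := j.isLt; omega⟩ : Fin N) 1)) ^ 2 / f x)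
      ∂(gibbsPi β V τ N)

open Filter Topology

theorem cutoff_pointwise_bound {β c a t w d e : ℝ} (hβ : 0 < β) (ha : 0 < a)
    (ht0 : 0 ≤ t) (ht1 : t ≤ 1) (hd : d ≤ c) (hc : 0 ≤ c) (s : ℝ) :
    β / 2 * (w ^ 2 * t ^ 2 * a) + (d * t ^ 2 * a + 2 * w * t * s * a + w * t ^ 2 * e
      - β * (w ^ 2 * t ^ 2 * a)) ≤ (c + 4 / β * s ^ 2) * a + 1 / β * (e ^ 2 / a) := by
  have ht : t ^ 2 ≤ 1 := pow_le_one₀ ht0 ht1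
  have h1 : d * t ^ 2 * a ≤ c * a := by
    have : d * t ^ 2 ≤ c := by nlinarith [sq_nonneg t]
    exact mul_le_mul_of_nonneg_right this ha.le
  have h2 : 2 * w * t * s * a ≤ β / 4 * (w ^ 2 * t ^ 2 * a) + 4 / β * s ^ 2 * a := by
    have : β / 4 * (w ^ 2 * t ^ 2 * a) + 4 / β * s ^ 2 * a - 2 * w * t * s * a
        = a / (4 * β) * (β * (w * t) - 4 * s) ^ 2 := by field_simp; ring
    have : 0 ≤ a / (4 * β) * (β * (w * t) - 4 * s) ^ 2 := by positivity
    linarith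
  have h3 : w * t ^ 2 * e ≤ β / 4 * (w ^ 2 * t ^ 2 * a) + 1 / β * (e ^ 2 / a) := by
    have h4 : β / 4 * (w ^ 2 * t ^ 2 * a) + 1 / β * (e ^ 2 * t ^ 2 / a) - w * t ^ 2 * e
        = t ^ 2 / (4 * β * a) * (β * w * a - 2 * e) ^ 2 := by field_simp; ring
    have : 0 ≤ t ^ 2 / (4 * β * a) * (β * w * a - 2 * e) ^ 2 := by positivity
    have h5 : e ^ 2 * t ^ 2 / a ≤ e ^ 2 / a := by
      apply div_le_div_of_nonneg_right _ ha.le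
      nlinarith [sq_nonneg e]
    have h6 : 1 / β * (e ^ 2 * t ^ 2 / a) ≤ 1 / β * (e ^ 2 / a) :=
      mul_le_mul_of_nonneg_left h5 (by positivity)
    linarith
  linarith

theorem ofReal_integral_le_lintegral_ofReal {α : Type*} [MeasurableSpace α] {μ : Measure α}
    {g : α → ℝ} (hg : Integrable g μ) :
    ENNReal.ofReal (∫ x, g x ∂μ) ≤ ∫⁻ x, ENNReal.ofReal (g x) ∂μ := by
  calc ENNReal.ofReal (∫ x, g x ∂μ) ≤ ENNReal.ofReal (∫ x, max (g x) 0 ∂μ) :=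
        ENNReal.ofReal_le_ofReal (integral_mono hg hg.pos_part fun x => le_max_left _ _)
    _ = ∫⁻ x, ENNReal.ofReal (max (g x) 0) ∂μ :=
        ofReal_integral_eq_lintegral_ofReal hg.pos_part (ae_of_all _ fun x => le_max_right _ _)
    _ = ∫⁻ x, ENNReal.ofReal (g x) ∂μ := by simp

theorem fderiv_mul_cutoff_sq_mul_mul {E : Type*} [NormedAddCommGroup E] [NormedSpace ℝ E]
    {W χ f ρ : E → ℝ} (hW : ContDiff ℝ 1 W)
    (hχ : ContDiff ℝ 1 χ) (hf : ContDiff ℝ 1 f) (hρ : ContDiff ℝ 1 ρ) (x v : E) :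
    fderiv ℝ (fun x => W x * χ x ^ 2 * f x * ρ x) x v =
      fderiv ℝ W x v * χ x ^ 2 * f x * ρ x + 2 * W x * χ x * fderiv ℝ χ x v * f x * ρ x +
        W x * χ x ^ 2 * fderiv ℝ f x v * ρ x + W x * χ x ^ 2 * f x * fderiv ℝ ρ x v := by
  have d {g : E → ℝ} (hg : ContDiff ℝ 1 g) : HasFDerivAt g (fderiv ℝ g x) x :=
    (hg.differentiable one_ne_zero x).hasFDerivAt
  have h : HasFDerivAt (fun x => W x * χ x ^ 2 * f x * ρ x) _ x :=
    (((d hW).mul ((d hχ).pow 2)).mul (d hf)).mul (d hρ)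
  rw [h.fderiv]
  simp
  ring

section Cutoff

variable {E : Type*} [NormedAddCommGroup E] [NormedSpace ℝ E] [FiniteDimensional ℝ E]

/-- Smooth compactly supported cutoffs exhausting the space, whose derivatives in a fixed direction
decay uniformly. -/
theorem exists_cutoff_seq (v : E) :
    ∃ (χ : ℕ → E → ℝ) (K : ℝ), (∀ n, ContDiff ℝ 1 (χ n)) ∧ (∀ n, HasCompactSupport (χ n)) ∧
      (∀ n x, 0 ≤ χ n x) ∧ (∀ n x, χ n x ≤ 1) ∧ (∀ x, ∀ᶠ n in atTop, χ n x = 1) ∧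
      (∀ n x, |fderiv ℝ (χ n) x v| ≤ K / (n + 1)) := by
  let b : ContDiffBump (0 : E) := ⟨1, 2, one_pos, one_lt_two⟩
  have hb : ContDiff ℝ 1 (b : E → ℝ) := b.contDiff
  have hb' : Continuous fun x => fderiv ℝ b x v :=
    (hb.continuous_fderiv one_ne_zero).clm_apply continuous_const
  have hbs : HasCompactSupport fun x => fderiv ℝ b x v :=
    b.hasCompactSupport.fderiv_apply (𝕜 := ℝ) v
  obtain ⟨K, hK⟩ := hb'.bounded_above_of_compact_support hbs
  have hpos (n : ℕ) : (0 : ℝ) < (n : ℝ) + 1 := by positivity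
  refine ⟨fun n x => b (((n : ℝ) + 1)⁻¹ • x), K, fun n => hb.comp (contDiff_const_smul _),
    fun n => ?_, fun n x => b.nonneg, fun n x => b.le_one, fun x => ?_, fun n x => ?_⟩
  · exact b.hasCompactSupport.comp_smul (inv_ne_zero (hpos n).ne')
  · filter_upwards [eventually_ge_atTop ⌈‖x‖⌉₊] with n hn
    apply b.one_of_mem_closedBall
    have hx : ‖x‖ ≤ n := (Nat.le_ceil _).trans (by exact_mod_cast hn)
    rw [mem_closedBall_zero_iff, norm_smul, norm_inv, Real.norm_of_nonneg (hpos n).le]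
    change _ ≤ (1 : ℝ)
    rw [inv_mul_le_iff₀ (hpos n)]
    linarith
  · have h : HasFDerivAt (fun x => b (((n : ℝ) + 1)⁻¹ • x))
        ((fderiv ℝ b (((n : ℝ) + 1)⁻¹ • x)).comp
          (((n : ℝ) + 1)⁻¹ • ContinuousLinearMap.id ℝ E)) x :=
      ((hb.differentiable one_ne_zero) _).hasFDerivAt.comp x
        ((hasFDerivAt_id x).const_smul _)
    rw [h.fderiv]
    simp only [ContinuousLinearMap.comp_apply, smul_apply,
      ContinuousLinearMap.id_apply, map_smul, smul_eq_mul, abs_mul, abs_inv, abs_of_pos (hpos n)]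
    rw [div_eq_inv_mul]
    exact mul_le_mul_of_nonneg_left (hK _) (inv_nonneg.2 (hpos n).le)

variable [MeasurableSpace E] [BorelSpace E] (μ : Measure E) [μ.IsAddHaarMeasure]

theorem integral_fderiv_apply_eq_zero {F : E → ℝ} (hF : ContDiff ℝ 1 F)
    (hFs : HasCompactSupport F) (v : E) : ∫ x, fderiv ℝ F x v ∂μ = 0 := by
  have hF' : Continuous fun x => fderiv ℝ F x v :=
    (hF.continuous_fderiv one_ne_zero).clm_apply continuous_const
  have hFs' : HasCompactSupport fun x => fderiv ℝ F x v := hFs.fderiv_apply (𝕜 := ℝ) v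
  have := integral_mul_fderiv_eq_neg_fderiv_mul_of_integrable (𝕜 := ℝ) (μ := μ)
    (f := fun _ : E => (1 : ℝ)) (g := F) (v := v)
    (by simp) (by simpa using hF'.integrable_of_hasCompactSupport hFs')
    (by simpa using hF.continuous.integrable_of_hasCompactSupport hFs)
    (fun x _ => differentiableAt_const _) (fun x _ => hF.differentiable one_ne_zero x)
  simpa using this


variable {W f ρ : E → ℝ} {v : E} {β c : ℝ}

theorem lintegral_cutoff_sq_mul_le (hβ : 0 < β) (hc : 0 ≤ c)
    (hW : ContDiff ℝ 1 W) (hf : ContDiff ℝ 1 f) (hρ : ContDiff ℝ 1 ρ)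
    (hf0 : ∀ x, 0 < f x) (hρ0 : ∀ x, 0 < ρ x)
    (hρW : ∀ x, fderiv ℝ ρ x v = -β * W x * ρ x) (hWc : ∀ x, fderiv ℝ W x v ≤ c)
    {χ : E → ℝ} (hχ : ContDiff ℝ 1 χ) (hχs : HasCompactSupport χ)
    (hχ0 : ∀ x, 0 ≤ χ x) (hχ1 : ∀ x, χ x ≤ 1) {δ : ℝ} (hχδ : ∀ x, |fderiv ℝ χ x v| ≤ δ)
    (hfρ : ∫⁻ x, ENNReal.ofReal (f x * ρ x) ∂μ = 1) :
    ∫⁻ x, ENNReal.ofReal (W x ^ 2 * χ x ^ 2 * f x * ρ x) ∂μ ≤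
      ENNReal.ofReal (2 / β * (c + 4 / β * δ ^ 2)) + ENNReal.ofReal (2 / β ^ 2) *
        ∫⁻ x, ENNReal.ofReal (fderiv ℝ f x v ^ 2 / f x * ρ x) ∂μ := by
  set F : E → ℝ := fun x => W x * χ x ^ 2 * f x * ρ x with hF
  have hFc : ContDiff ℝ 1 F := ((hW.mul (hχ.pow 2)).mul hf).mul hρ
  have hχ2 : HasCompactSupport fun x => χ x ^ 2 :=
    hχs.comp_left (g := fun t : ℝ => t ^ 2) (by norm_num)
  have hFs : HasCompactSupport F := ((hχ2.mul_left (f := W)).mul_right (f' := f)).mul_right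
  have hF' : Continuous fun x => fderiv ℝ F x v :=
    (hFc.continuous_fderiv one_ne_zero).clm_apply continuous_const
  have hFi : Integrable (fun x => fderiv ℝ F x v) μ :=
    hF'.integrable_of_hasCompactSupport (hFs.fderiv_apply (𝕜 := ℝ) v)
  set A : E → ℝ := fun x => W x ^ 2 * χ x ^ 2 * f x * ρ x with hA
  have hAc : Continuous A :=
    (((hW.continuous.pow 2).mul (hχ.continuous.pow 2)).mul hf.continuous).mul hρ.continuous
  have hAs : HasCompactSupport A :=
    ((hχ2.mul_left (f := fun x => W x ^ 2)).mul_right (f' := f)).mul_right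
  have hAi : Integrable A μ := hAc.integrable_of_hasCompactSupport hAs
  have hA0 : ∀ x, 0 ≤ A x := fun x => by have := hf0 x; have := hρ0 x; positivity
  have hpt : ∀ x, β / 2 * A x + fderiv ℝ F x v ≤
      (c + 4 / β * δ ^ 2) * (f x * ρ x) + 1 / β * (fderiv ℝ f x v ^ 2 / f x * ρ x) := by
    intro x
    have h := cutoff_pointwise_bound (w := W x) (e := fderiv ℝ f x v) hβ (hf0 x) (hχ0 x) (hχ1 x)
      (hWc x) hc (fderiv ℝ χ x v)
    have hs : fderiv ℝ χ x v ^ 2 ≤ δ ^ 2 := sq_le_sq' (abs_le.1 (hχδ x)).1 (abs_le.1 (hχδ x)).2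
    have hs' : (c + 4 / β * fderiv ℝ χ x v ^ 2) * f x ≤ (c + 4 / β * δ ^ 2) * f x := by
      have := hf0 x
      gcongr
    have := mul_le_mul_of_nonneg_right (h.trans (add_le_add_left hs' _)) (hρ0 x).le
    rw [fderiv_mul_cutoff_sq_mul_mul hW hχ hf hρ, hρW, hA]
    linarith
  have hfm : Measurable fun x => ENNReal.ofReal (f x * ρ x) :=
    (hf.continuous.mul hρ.continuous).measurable.ennreal_ofReal
  have hq : 0 ≤ c + 4 / β * δ ^ 2 := by positivity
  set D : ℝ≥0∞ := ∫⁻ x, ENNReal.ofReal (fderiv ℝ f x v ^ 2 / f x * ρ x) ∂μ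
  have hint : ENNReal.ofReal (∫ x, (β / 2 * A x + fderiv ℝ F x v) ∂μ) ≤
      ENNReal.ofReal (c + 4 / β * δ ^ 2) + ENNReal.ofReal (1 / β) * D := by
    calc _ ≤ ∫⁻ x, ENNReal.ofReal (β / 2 * A x + fderiv ℝ F x v) ∂μ :=
          ofReal_integral_le_lintegral_ofReal ((hAi.const_mul _).add hFi)
      _ ≤ ∫⁻ x, (ENNReal.ofReal (c + 4 / β * δ ^ 2) * ENNReal.ofReal (f x * ρ x) +
            ENNReal.ofReal (1 / β) * ENNReal.ofReal (fderiv ℝ f x v ^ 2 / f x * ρ x)) ∂μ := by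
          refine lintegral_mono fun x => (ENNReal.ofReal_le_ofReal (hpt x)).trans ?_
          rw [← ENNReal.ofReal_mul hq, ← ENNReal.ofReal_mul (by positivity)]
          exact ENNReal.ofReal_add_le
      _ = _ := by
          rw [lintegral_add_left (hfm.const_mul _), lintegral_const_mul _ hfm, hfρ, mul_one,
            lintegral_const_mul' _ _ ENNReal.ofReal_ne_top]
  rw [integral_add (hAi.const_mul _) hFi, integral_fderiv_apply_eq_zero μ hFc hFs, add_zero,
    integral_const_mul] at hint
  rw [← ofReal_integral_eq_lintegral_ofReal hAi (ae_of_all _ hA0)]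
  have hscale : ∫ x, A x ∂μ = 2 / β * (β / 2 * ∫ x, A x ∂μ) := by field_simp
  have h2β : 0 ≤ 2 / β := by positivity
  rw [hscale, ENNReal.ofReal_mul h2β]
  refine (mul_le_mul_right hint _).trans_eq ?_
  rw [mul_add, ← ENNReal.ofReal_mul h2β, ← mul_assoc, ← ENNReal.ofReal_mul h2β]
  have hββ : 2 / β * (1 / β) = 2 / β ^ 2 := by field_simp
  rw [hββ]

/-- If `W` is, up to the factor `β`, the divergence of the direction `v` with respect to the
density `ρ`, then the second moment of `W` under `f ρ` is controlled by the derivative of `W`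
along `v` and by the Fisher information of `f` along `v`. -/
theorem lintegral_sq_mul_le_of_fderiv_eq (hβ : 0 < β) (hc : 0 ≤ c)
    (hW : ContDiff ℝ 1 W) (hf : ContDiff ℝ 1 f) (hρ : ContDiff ℝ 1 ρ)
    (hf0 : ∀ x, 0 < f x) (hρ0 : ∀ x, 0 < ρ x)
    (hρW : ∀ x, fderiv ℝ ρ x v = -β * W x * ρ x) (hWc : ∀ x, fderiv ℝ W x v ≤ c)
    (hfρ : ∫⁻ x, ENNReal.ofReal (f x * ρ x) ∂μ = 1) :
    ∫⁻ x, ENNReal.ofReal (W x ^ 2 * f x * ρ x) ∂μ ≤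
      ENNReal.ofReal (2 / β * c) + ENNReal.ofReal (2 / β ^ 2) *
        ∫⁻ x, ENNReal.ofReal (fderiv ℝ f x v ^ 2 / f x * ρ x) ∂μ := by
  obtain ⟨χ, K, hχ, hχs, hχ0, hχ1, hχt, hχK⟩ := exists_cutoff_seq v
  set D : ℝ≥0∞ := ∫⁻ x, ENNReal.ofReal (fderiv ℝ f x v ^ 2 / f x * ρ x) ∂μ
  have hbd (n : ℕ) := lintegral_cutoff_sq_mul_le μ hβ hc hW hf hρ hf0 hρ0 hρW hWc (hχ n) (hχs n)
    (hχ0 n) (hχ1 n) (hχK n) hfρ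
  have hlim : Tendsto (fun n : ℕ => ENNReal.ofReal (2 / β * (c + 4 / β * (K / (n + 1)) ^ 2)) +
      ENNReal.ofReal (2 / β ^ 2) * D) atTop
      (𝓝 (ENNReal.ofReal (2 / β * c) + ENNReal.ofReal (2 / β ^ 2) * D)) := by
    refine Tendsto.add (ENNReal.tendsto_ofReal ?_) tendsto_const_nhds
    have h0 : Tendsto (fun n : ℕ => K / ((n : ℝ) + 1)) atTop (𝓝 0) := by
      simpa [div_eq_mul_inv] using (tendsto_one_div_add_atTop_nhds_zero_nat (𝕜 := ℝ)).const_mul K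
    simpa using (((h0.pow 2).const_mul (4 / β)).const_add c).const_mul (2 / β)
  have hpt (x : E) : liminf (fun n => ENNReal.ofReal (W x ^ 2 * χ n x ^ 2 * f x * ρ x)) atTop =
      ENNReal.ofReal (W x ^ 2 * f x * ρ x) := by
    refine (tendsto_const_nhds.congr' ?_).liminf_eq
    filter_upwards [hχt x] with n hn
    simp [hn]
  calc _ = ∫⁻ x, liminf (fun n => ENNReal.ofReal (W x ^ 2 * χ n x ^ 2 * f x * ρ x)) atTop ∂μ := by
        simp_rw [hpt]
    _ ≤ liminf (fun n => ∫⁻ x, ENNReal.ofReal (W x ^ 2 * χ n x ^ 2 * f x * ρ x) ∂μ) atTop := by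
        refine lintegral_liminf_le fun n => ?_
        have h1 := hW.continuous
        have h2 := (hχ n).continuous
        have h3 := hf.continuous
        have h4 := hρ.continuous
        exact Measurable.ennreal_ofReal (Continuous.measurable (by fun_prop))
    _ ≤ liminf (fun n : ℕ => ENNReal.ofReal (2 / β * (c + 4 / β * (K / (n + 1)) ^ 2)) +
          ENNReal.ofReal (2 / β ^ 2) * D) atTop := liminf_le_liminf (Eventually.of_forall hbd)
    _ = _ := hlim.liminf_eq

end Cutoff

/-- The `n`-th (0-indexed) coordinate vector, extended by `0` out of range. -/
noncomputable def unitVec (N n : ℕ) : Fin N → ℝ :=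
  if h : n < N then Pi.single ⟨n, h⟩ 1 else 0

/-- The direction averaging `e_{k+i} - e_{k-l+i}` over the two adjacent blocks of length `l`. -/
noncomputable def blockDir (N l k : ℕ) : Fin N → ℝ :=
  (1 / (l : ℝ)) • ∑ j ∈ Finset.Icc 1 l, (unitVec N (k + l - j) - unitVec N (k - j))

theorem clm_apply_blockDir {N : ℕ} (L : (Fin N → ℝ) →L[ℝ] ℝ) (l k : ℕ) :
    L (blockDir N l k) = (1 / (l : ℝ)) *
      ∑ j ∈ Finset.Icc 1 l, (L (unitVec N (k + l - j)) - L (unitVec N (k - j))) := by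
  simp [blockDir, map_sum]

theorem exists_clm_eq_coord (N n : ℕ) :
    ∃ L : (Fin N → ℝ) →L[ℝ] ℝ, ∀ x, L x = coord x n := by
  by_cases h : n - 1 < N
  · exact ⟨ContinuousLinearMap.proj ⟨n - 1, h⟩, fun x => by simp [coord, h]⟩
  · exact ⟨0, fun x => by simp [coord, h]⟩

theorem coord_succ {N n : ℕ} (x : Fin N → ℝ) (h : n < N) : coord x (n + 1) = x ⟨n, h⟩ := by
  simp [coord, h]

theorem coord_unitVec {N n : ℕ} (m : ℕ) (h : n < N) :
    coord (unitVec N m) (n + 1) = if n = m then 1 else 0 := by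
  rw [coord_succ _ h, unitVec]
  split_ifs with hm hnm hnm
  · subst hnm; simp
  · simp [hnm]
  · omega
  · rfl

theorem coord_blockDir {N l k : ℕ} (n : ℕ) (h : n < N) :
    coord (blockDir N l k) (n + 1) = (1 / (l : ℝ)) * ∑ j ∈ Finset.Icc 1 l,
      ((if n = k + l - j then 1 else 0) - (if n = k - j then 1 else 0)) := by
  obtain ⟨L, hL⟩ := exists_clm_eq_coord N (n + 1)
  rw [← hL, clm_apply_blockDir]
  simp only [hL, coord_unitVec _ h]

theorem coord_blockDir_right {N l k i : ℕ} (hlk : l ≤ k) (hN : k + l ≤ N)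
    (hi : i ∈ Finset.Icc 1 l) : coord (blockDir N l k) (k + l - i + 1) = 1 / (l : ℝ) := by
  have hi' := Finset.mem_Icc.1 hi
  rw [coord_blockDir _ (by omega), Finset.sum_eq_single_of_mem i hi]
  · rw [if_pos rfl, if_neg (by omega)]; simp
  · intro j hj hji
    have := Finset.mem_Icc.1 hj
    rw [if_neg (by omega), if_neg (by omega), sub_zero]

theorem coord_blockDir_left {N l k i : ℕ} (hlk : l ≤ k) (hN : k + l ≤ N)
    (hi : i ∈ Finset.Icc 1 l) : coord (blockDir N l k) (k - i + 1) = -(1 / (l : ℝ)) := by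
  have hi' := Finset.mem_Icc.1 hi
  rw [coord_blockDir _ (by omega), Finset.sum_eq_single_of_mem i hi]
  · rw [if_pos rfl, if_neg (by omega)]; simp
  · intro j hj hji
    have := Finset.mem_Icc.1 hj
    rw [if_neg (by omega), if_neg (by omega), sub_zero]

theorem sq_sub_le_mul_sum_sq (d : ℕ → ℝ) {m l M : ℕ} (h : m + l ≤ M) :
    (d (m + l) - d m) ^ 2 ≤ l * ∑ i ∈ Finset.range M, (d (i + 1) - d i) ^ 2 := by
  rw [← Finset.sum_Ico_sub d (Nat.le_add_right m l)]
  refine sq_sum_le_card_mul_sum_sq.trans ?_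
  rw [Nat.card_Ico, Nat.add_sub_cancel_left]
  refine mul_le_mul_of_nonneg_left ?_ (Nat.cast_nonneg _)
  refine Finset.sum_le_sum_of_subset_of_nonneg (fun i hi => ?_) fun i _ _ => sq_nonneg _
  have := Finset.mem_Ico.1 hi
  exact Finset.mem_range.2 (by omega)

theorem clm_apply_blockDir_sq_le {N l k : ℕ} (L : (Fin N → ℝ) →L[ℝ] ℝ) (hl : 1 ≤ l)
    (hlk : l ≤ k) (hN : k + l ≤ N) :
    L (blockDir N l k) ^ 2 ≤ l * ∑ j : Fin (N - 1),
      (L (Pi.single (⟨j.1 + 1, by have := j.isLt; omega⟩ : Fin N) 1) -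
        L (Pi.single (⟨j.1, by have := j.isLt; omega⟩ : Fin N) 1)) ^ 2 := by
  have hl0 : (0 : ℝ) < l := by exact_mod_cast hl
  set S := ∑ i ∈ Finset.range (N - 1), (L (unitVec N (i + 1)) - L (unitVec N i)) ^ 2 with hS
  have hS' : ∑ j : Fin (N - 1),
      (L (Pi.single (⟨j.1 + 1, by have := j.isLt; omega⟩ : Fin N) 1) -
        L (Pi.single (⟨j.1, by have := j.isLt; omega⟩ : Fin N) 1)) ^ 2 = S := by
    rw [hS, Finset.sum_range]
    refine Finset.sum_congr rfl fun j _ => ?_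
    have := j.isLt
    simp only [unitVec]
    rw [dif_pos (show j.1 + 1 < N by omega), dif_pos (show j.1 < N by omega)]
  rw [hS', clm_apply_blockDir, mul_pow]
  have h1 : (∑ j ∈ Finset.Icc 1 l, (L (unitVec N (k + l - j)) - L (unitVec N (k - j)))) ^ 2 ≤
      l * ∑ j ∈ Finset.Icc 1 l, l * S := by
    refine sq_sum_le_card_mul_sum_sq.trans ?_
    rw [Nat.card_Icc, Nat.add_sub_cancel]
    refine mul_le_mul_of_nonneg_left (Finset.sum_le_sum fun j hj => ?_) hl0.le
    have := Finset.mem_Icc.1 hj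
    rw [show k + l - j = k - j + l by omega]
    exact sq_sub_le_mul_sum_sq (fun n => L (unitVec N n)) (by omega)
  refine (mul_le_mul_of_nonneg_left h1 (by positivity)).trans_eq ?_
  rw [Finset.sum_const, Nat.card_Icc, Nat.add_sub_cancel, nsmul_eq_mul]
  field_simp

section Gibbs

variable {β : ℝ} {V : ℝ → ℝ} {τ : ℝ} {N : ℕ}

theorem prod_gibbsDensity_eq_exp (x : Fin N → ℝ) : ∏ i, gibbsDensity β V τ (x i) =
    Real.exp (∑ i, (-β * V (x i) + β * τ * x i - gibbsG β V τ)) := by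
  simp only [gibbsDensity, Real.exp_sum]

theorem contDiff_prod_gibbsDensity (hV : ContDiff ℝ 2 V) :
    ContDiff ℝ 1 fun x : Fin N → ℝ => ∏ i, gibbsDensity β V τ (x i) := by
  have hV1 : ContDiff ℝ 1 V := hV.of_le one_le_two
  unfold gibbsDensity
  fun_prop

theorem prod_gibbsDensity_pos (x : Fin N → ℝ) : 0 < ∏ i, gibbsDensity β V τ (x i) :=
  Finset.prod_pos fun _ _ => Real.exp_pos _

theorem fderiv_prod_gibbsDensity (hV : Differentiable ℝ V) (x v : Fin N → ℝ) :
    fderiv ℝ (fun x : Fin N → ℝ => ∏ i, gibbsDensity β V τ (x i)) x v =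
      (∏ i, gibbsDensity β V τ (x i)) * ∑ i, (-β * deriv V (x i) + β * τ) * v i := by
  have h1 (i : Fin N) : HasFDerivAt
      (fun x : Fin N → ℝ => -β * V (x i) + β * τ * x i - gibbsG β V τ)
      ((-β * deriv V (x i) + β * τ) • ContinuousLinearMap.proj (R := ℝ) (φ := fun _ => ℝ) i) x := by
    have h2 : HasDerivAt (fun r => -β * V r + β * τ * r - gibbsG β V τ)
        (-β * deriv V (x i) + β * τ) (x i) := by
      simpa using (((hV (x i)).hasDerivAt.const_mul (-β)).add
        ((hasDerivAt_id (x i)).const_mul (β * τ))).sub_const (gibbsG β V τ)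
    have h3 : HasFDerivAt (fun x : Fin N → ℝ => x i)
        (ContinuousLinearMap.proj (R := ℝ) (φ := fun _ => ℝ) i) x := hasFDerivAt_apply i x
    exact h2.comp_hasFDerivAt x h3
  have h3 := (HasFDerivAt.fun_sum (u := Finset.univ) fun i _ => h1 i).exp
  simp_rw [prod_gibbsDensity_eq_exp]
  rw [h3.fderiv]
  simp

theorem fderiv_prod_gibbsDensity_unitVec (hV : Differentiable ℝ V) (x : Fin N → ℝ) {n : ℕ}
    (hn : n < N) :
    fderiv ℝ (fun x : Fin N → ℝ => ∏ i, gibbsDensity β V τ (x i)) x (unitVec N n) =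
      (∏ i, gibbsDensity β V τ (x i)) * (-β * deriv V (coord x (n + 1)) + β * τ) := by
  rw [fderiv_prod_gibbsDensity hV, coord_succ x hn, unitVec, dif_pos hn]
  simp [Pi.single_apply]

theorem fderiv_prod_gibbsDensity_blockDir (hV : Differentiable ℝ V) (x : Fin N → ℝ) {l k : ℕ}
    (hlk : l ≤ k) (hN : k + l ≤ N) :
    fderiv ℝ (fun x : Fin N → ℝ => ∏ i, gibbsDensity β V τ (x i)) x (blockDir N l k) =
      -β * (forceBlockAvg V l (k + l) x - forceBlockAvg V l k x) *
        ∏ i, gibbsDensity β V τ (x i) := by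
  rw [clm_apply_blockDir, forceBlockAvg, forceBlockAvg, ← mul_sub, ← Finset.sum_sub_distrib,
    mul_left_comm, mul_assoc]
  congr 1
  rw [Finset.mul_sum, Finset.sum_mul]
  refine Finset.sum_congr rfl fun j hj => ?_
  have := Finset.mem_Icc.1 hj
  rw [fderiv_prod_gibbsDensity_unitVec hV x (by omega),
    fderiv_prod_gibbsDensity_unitVec hV x (by omega)]
  ring

theorem hasFDerivAt_deriv_coord (hV : Differentiable ℝ (deriv V)) (x : Fin N → ℝ) (n : ℕ) :
    ∃ L : (Fin N → ℝ) →L[ℝ] ℝ, HasFDerivAt (fun x : Fin N → ℝ => deriv V (coord x n)) L x ∧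
      ∀ v, L v = deriv (deriv V) (coord x n) * coord v n := by
  obtain ⟨L, hL⟩ := exists_clm_eq_coord N n
  refine ⟨deriv (deriv V) (coord x n) • L, ?_, fun v => by simp [hL]⟩
  have h : HasFDerivAt (fun x : Fin N → ℝ => coord x n) L x := by
    rw [← funext hL]; exact L.hasFDerivAt
  exact (hV _).hasDerivAt.comp_hasFDerivAt x h

theorem contDiff_forceBlockAvg (hV : ContDiff ℝ 2 V) (l i : ℕ) :
    ContDiff ℝ 1 fun x : Fin N → ℝ => forceBlockAvg V l i x := by
  have hV1 : ContDiff ℝ 1 (deriv V) := ((contDiff_succ_iff_deriv (n := 1)).1 hV).2.2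
  refine contDiff_const.mul (ContDiff.sum fun j _ => hV1.comp ?_)
  obtain ⟨L, hL⟩ := exists_clm_eq_coord N (i - j + 1)
  rw [← funext hL]; exact L.contDiff

theorem fderiv_forceBlockAvg (hV : ContDiff ℝ 2 V) (l i : ℕ) (x v : Fin N → ℝ) :
    fderiv ℝ (fun x : Fin N → ℝ => forceBlockAvg V l i x) x v = (1 / (l : ℝ)) *
      ∑ j ∈ Finset.Icc 1 l,
        deriv (deriv V) (coord x (i - j + 1)) * coord v (i - j + 1) := by
  have hV1 : Differentiable ℝ (deriv V) :=
    (((contDiff_succ_iff_deriv (n := 1)).1 hV).2.2).differentiable one_ne_zero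
  choose L hL hLv using hasFDerivAt_deriv_coord (N := N) hV1 x
  have h : HasFDerivAt (fun x : Fin N → ℝ => forceBlockAvg V l i x) _ x :=
    (HasFDerivAt.fun_sum (u := Finset.Icc 1 l) fun j _ => hL (i - j + 1)).const_mul (1 / (l : ℝ))
  rw [h.fderiv]
  simp [hLv]

theorem fderiv_forceBlockAvg_sub_blockDir_le {c : ℝ} (hV : ContDiff ℝ 2 V)
    (hc : ∀ r, deriv (deriv V) r ≤ c) {l k : ℕ} (hl : 1 ≤ l) (hlk : l ≤ k) (hN : k + l ≤ N)
    (x : Fin N → ℝ) :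
    fderiv ℝ (fun x : Fin N → ℝ => forceBlockAvg V l (k + l) x - forceBlockAvg V l k x) x
      (blockDir N l k) ≤ 2 * c / l := by
  have hl0 : (0 : ℝ) < l := by exact_mod_cast hl
  have hd (i : ℕ) : DifferentiableAt ℝ (fun x : Fin N → ℝ => forceBlockAvg V l i x) x :=
    (contDiff_forceBlockAvg hV l i).differentiable one_ne_zero x
  rw [fderiv_fun_sub (hd _) (hd _), sub_apply, fderiv_forceBlockAvg hV,
    fderiv_forceBlockAvg hV, ← mul_sub, ← Finset.sum_sub_distrib]
  have : ∑ j ∈ Finset.Icc 1 l, (deriv (deriv V) (coord x (k + l - j + 1)) *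
      coord (blockDir N l k) (k + l - j + 1) - deriv (deriv V) (coord x (k - j + 1)) *
      coord (blockDir N l k) (k - j + 1)) ≤ ∑ j ∈ Finset.Icc 1 l, 2 * c / l := by
    refine Finset.sum_le_sum fun j hj => ?_
    rw [coord_blockDir_right hlk hN hj, coord_blockDir_left hlk hN hj, mul_neg, sub_neg_eq_add,
      ← add_mul, mul_one_div]
    gcongr
    linarith [hc (coord x (k + l - j + 1)), hc (coord x (k - j + 1))]
  refine (mul_le_mul_of_nonneg_left this (by positivity)).trans_eq ?_
  rw [Finset.sum_const, Nat.card_Icc, Nat.add_sub_cancel, nsmul_eq_mul]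
  field_simp

theorem lintegral_gibbsPi_ofReal (hV : ContDiff ℝ 2 V) (g : (Fin N → ℝ) → ℝ) :
    ∫⁻ x, ENNReal.ofReal (g x) ∂(gibbsPi β V τ N) =
      ∫⁻ x, ENNReal.ofReal (g x * ∏ i, gibbsDensity β V τ (x i)) := by
  have hm : Measurable fun x : Fin N → ℝ => ENNReal.ofReal (∏ i, gibbsDensity β V τ (x i)) :=
    (contDiff_prod_gibbsDensity hV).continuous.measurable.ennreal_ofReal
  rw [gibbsPi, lintegral_withDensity_eq_lintegral_mul_non_measurable _ hm
    (ae_of_all _ fun x => ENNReal.ofReal_lt_top)]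
  refine lintegral_congr fun x => ?_
  rw [Pi.mul_apply, mul_comm, ENNReal.ofReal_mul' (prod_gibbsDensity_pos x).le]

theorem lintegral_fderiv_blockDir_sq_div_le {f : (Fin N → ℝ) → ℝ}
    (hf : ContDiff ℝ 1 f) (hf0 : ∀ x, 0 < f x) {l k : ℕ} (hl : 1 ≤ l) (hlk : l ≤ k)
    (hN : k + l ≤ N) :
    ∫⁻ x, ENNReal.ofReal (fderiv ℝ f x (blockDir N l k) ^ 2 / f x) ∂(gibbsPi β V τ N) ≤
      l * stretchDirichlet β V τ N f := by
  have hm (w : Fin N → ℝ) : Measurable fun x => fderiv ℝ f x w :=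
    ((hf.continuous_fderiv one_ne_zero).clm_apply continuous_const).measurable
  have hfm : Measurable f := hf.continuous.measurable
  have hm' (w w' : Fin N → ℝ) : Measurable fun x =>
      ENNReal.ofReal ((fderiv ℝ f x w - fderiv ℝ f x w') ^ 2 / f x) :=
    ((((hm w).sub (hm w')).pow_const 2).div hfm).ennreal_ofReal
  rw [stretchDirichlet, ← lintegral_finsetSum _ fun j _ => hm' _ _,
    ← lintegral_const_mul' _ _ (ENNReal.natCast_ne_top l)]
  refine lintegral_mono fun x => ?_
  rw [← ENNReal.ofReal_sum_of_nonneg fun j _ => div_nonneg (sq_nonneg _) (hf0 x).le,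
    ← ENNReal.ofReal_natCast, ← ENNReal.ofReal_mul (Nat.cast_nonneg _), ← Finset.sum_div,
    ← mul_div_assoc]
  exact ENNReal.ofReal_le_ofReal
    (div_le_div_of_nonneg_right (clm_apply_blockDir_sq_le _ hl hlk hN) (hf0 x).le)

end Gibbs

/-- one-and-a-half-block estimate, force version. There is a constant
`C`, depending only on `β` and `c₂`, such that for all `1 ≤ l ≤ k ≤ N - l` and every
smooth strictly positive probability density `f` with respect to `λ^N_{β,τ₀}`:
`∫ (V̄'_{l,k+l} - V̄'_{l,k})² f dλ^N ≤ C (1/l + l D̃(f))`. -/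
theorem one_and_half_block_estimate_force
    (β c₂ : ℝ) (hβ : 0 < β) (hc₂ : 0 < c₂) :
    ∃ C : ℝ, 0 < C ∧
      ∀ (c₁ : ℝ), 0 < c₁ → c₁ ≤ c₂ →
      ∀ (V : ℝ → ℝ), ContDiff ℝ 2 V →
        (∀ r : ℝ, c₁ ≤ deriv (deriv V) r ∧ deriv (deriv V) r ≤ c₂) →
      ∀ (τ₀ : ℝ) (N l k : ℕ), 1 ≤ l → l ≤ k → k + l ≤ N →
      ∀ (f : (Fin N → ℝ) → ℝ), ContDiff ℝ (⊤ : ℕ∞) f → (∀ x, 0 < f x) →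
        (∫⁻ x, ENNReal.ofReal (f x) ∂(gibbsPi β V τ₀ N)) = 1 →
        (∫⁻ x, ENNReal.ofReal
            ((forceBlockAvg V l (k + l) x - forceBlockAvg V l k x) ^ 2 * f x)
            ∂(gibbsPi β V τ₀ N)) ≤
          ENNReal.ofReal C *
            (ENNReal.ofReal (1 / (l : ℝ)) +
              (l : ℝ≥0∞) * stretchDirichlet β V τ₀ N f) := by
  refine ⟨4 * c₂ / β + 2 / β ^ 2, by positivity, ?_⟩
  intro c₁ _ _ V hV hc τ₀ N l k hl hlk hN f hf hf0 hf1
  have hl0 : (0 : ℝ) < l := by exact_mod_cast hl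
  have hf' : ContDiff ℝ 1 f := hf.of_le (by exact_mod_cast le_top)
  have hmain := lintegral_sq_mul_le_of_fderiv_eq (volume : Measure (Fin N → ℝ)) hβ
    (c := 2 * c₂ / l) (v := blockDir N l k) (by positivity)
    ((contDiff_forceBlockAvg hV l (k + l)).sub (contDiff_forceBlockAvg hV l k)) hf'
    (contDiff_prod_gibbsDensity (β := β) (τ := τ₀) hV) hf0 prod_gibbsDensity_pos
    (fun x => fderiv_prod_gibbsDensity_blockDir (hV.differentiable two_ne_zero) x hlk hN)
    (fun x => fderiv_forceBlockAvg_sub_blockDir_le hV (fun r => (hc r).2) hl hlk hN x)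
    (by rw [← lintegral_gibbsPi_ofReal hV, hf1])
  rw [← lintegral_gibbsPi_ofReal hV, ← lintegral_gibbsPi_ofReal hV] at hmain
  refine hmain.trans ?_
  rw [mul_add]
  refine add_le_add ?_ (mul_le_mul' (ENNReal.ofReal_le_ofReal ?_)
    (lintegral_fderiv_blockDir_sq_div_le hf' hf0 hl hlk hN))
  · rw [← ENNReal.ofReal_mul (by positivity)]
    refine ENNReal.ofReal_le_ofReal ?_
    have : 2 / β * (2 * c₂ / l) = 4 * c₂ / β * (1 / l) := by ring
    rw [this]
    gcongr
    exact le_add_of_nonneg_right (by positivity)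
  · exact le_add_of_nonneg_left (by positivity)
end

section
/- There exists a constant C, depending only on β, with the following property (one-and-a-half-block estimate, momentum version). For all integers N, l, k with 1 ≤ l ≤ k ≤ N−l, and every smooth strictly positive probability density f with respect to λ^N_{β,0,τ₀}: ∫ ( p̄_{l,k+l} − p̄_{l,k} )² f dλ^N_{β,0,τ₀} ≤ C ( 1/l + l · D(f) ), where p̄_{l,i} := (1/l) Σ_{j=1}^{l} p_{i−j+1}. -/
open MeasureTheory Real Set Finset
open scoped ENNReal

/-- One-site Gibbs density on `ℝ²` (coordinates `(r,p)`):
`(2πβ⁻¹)^{-1/2} exp(-βp²/2 - βV(r) + βτr - G(τ))`. -/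
noncomputable def gibbsDensity2 (β : ℝ) (V : ℝ → ℝ) (τ : ℝ) (q : ℝ × ℝ) : ℝ :=
  (Real.sqrt (2 * Real.pi * β⁻¹))⁻¹ *
    Real.exp (-β * q.2 ^ 2 / 2 - β * V q.1 + β * τ * q.1 - gibbsG β V τ)

/-- The `N`-fold product Gibbs measure `λ^N_{β,0,τ}` on `(ℝ²)^N`. -/
noncomputable def gibbsPi2 (β : ℝ) (V : ℝ → ℝ) (τ : ℝ) (N : ℕ) :
    Measure (Fin N → ℝ × ℝ) :=
  volume.withDensity fun x => ENNReal.ofReal (∏ i, gibbsDensity2 β V τ (x i))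

/-- The phase-space coordinates `(r_1,p_1), …, (r_N,p_N)` (1-indexed),
extended by `0` out of range. -/
noncomputable def coord2 {N : ℕ} (x : Fin N → ℝ × ℝ) (n : ℕ) : ℝ × ℝ :=
  if h : n - 1 < N then x ⟨n - 1, h⟩ else 0

/-- Block average of the momenta: `p̄_{l,i} = (1/l) Σ_{j=1}^{l} p_{i-j+1}`. -/
noncomputable def momBlockAvg {N : ℕ} (l i : ℕ) (x : Fin N → ℝ × ℝ) : ℝ :=
  (1 / (l : ℝ)) * ∑ j ∈ Finset.Icc 1 l, (coord2 x (i - j + 1)).2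

/-- The momentum Dirichlet form
`D(f) = Σ_{j=1}^{N-1} ∫ (∂f/∂p_{j+1} - ∂f/∂p_j)²/f dλ^N`. -/
noncomputable def momDirichlet (β : ℝ) (V : ℝ → ℝ) (τ : ℝ) (N : ℕ)
    (f : (Fin N → ℝ × ℝ) → ℝ) : ℝ≥0∞ :=
  ∑ j : Fin (N - 1),
    ∫⁻ x, ENNReal.ofReal
      ((fderiv ℝ f x (Pi.single (⟨j.1 + 1, by have := j.isLt; omega⟩ : Fin N) ((0 : ℝ), (1 : ℝ))) -
        fderiv ℝ f x (Pi.single (⟨j.1, by have := j.isLt; omega⟩ : Fin N) ((0 : ℝ), (1 : ℝ)))) ^ 2 / f x)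
      ∂(gibbsPi2 β V τ N)

section LogDerivativeEstimate

variable {E : Type*} [NormedAddCommGroup E] [NormedSpace ℝ E] [FiniteDimensional ℝ E]
  [MeasurableSpace E] [BorelSpace E] {μ : Measure E} [μ.IsAddHaarMeasure]

/-- The integral of an integrable directional derivative of an integrable function vanishes. -/
lemma integral_eq_zero_of_hasLineDerivAt {h h' : E → ℝ} {u : E}
    (hh : Integrable h μ) (hh' : Integrable h' μ)
    (hd : ∀ x, HasLineDerivAt ℝ h (h' x) x u) : ∫ x, h' x ∂μ = 0 := by
  have := integral_bilinear_hasLineDerivAt_right_eq_neg_left_of_integrable (μ := μ)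
    (f := fun _ : E => (1 : ℝ)) (f' := fun _ => 0) (g := h) (g' := h') (v := u)
    (B := ContinuousLinearMap.mul ℝ ℝ) (by simp) (by simpa using hh') (by simpa using hh)
    (fun x _ => by simpa [HasLineDerivAt] using hasDerivAt_const (0 : ℝ) (1 : ℝ))
    (fun x _ => hd x)
  simpa using this

lemma hasDerivAt_div_one_add_mul_sq {ε : ℝ} (hε : 0 < ε) (y : ℝ) :
    HasDerivAt (fun y : ℝ => y / (1 + ε * y ^ 2))
      ((1 - ε * y ^ 2) / (1 + ε * y ^ 2) ^ 2) y := by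
  have hpos : 1 + ε * y ^ 2 ≠ 0 := by positivity
  have hden : HasDerivAt (fun y : ℝ => 1 + ε * y ^ 2) (ε * (2 * y)) y := by
    simpa using ((hasDerivAt_pow 2 y).const_mul ε).const_add 1
  refine ((hasDerivAt_id' y).div hden hpos).congr_deriv ?_
  congr 1
  ring

/-- Truncated version of the second moment bound: the observable `X ^ 2` is replaced by the bounded
observable `X ^ 2 / (1 + ε * X ^ 2)`. -/
lemma integral_truncated_sq_le {β ε : ℝ} (hβ : 0 < β) (hε : 0 < ε) {ρ f : E → ℝ}
    (hρc : Continuous ρ) (hρ : ∀ x, 0 < ρ x) (X : E →L[ℝ] ℝ) (u : E) (hXu : 0 ≤ X u)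
    (hd : ∀ x, HasLineDerivAt ℝ ρ (-β * X x * ρ x) x u)
    (hf : ContDiff ℝ 1 f) (hfpos : ∀ x, 0 < f x)
    (hfρ : Integrable (fun x => f x * ρ x) μ)
    (hDf : Integrable (fun x => fderiv ℝ f x u ^ 2 / f x * ρ x) μ) :
    Integrable (fun x => X x ^ 2 / (1 + ε * X x ^ 2) * (f x * ρ x)) μ ∧
    ∫ x, X x ^ 2 / (1 + ε * X x ^ 2) * (f x * ρ x) ∂μ ≤
      2 * X u / β * ∫ x, f x * ρ x ∂μ +
        1 / β ^ 2 * ∫ x, fderiv ℝ f x u ^ 2 / f x * ρ x ∂μ := by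
  have hden : ∀ x, 0 < 1 + ε * X x ^ 2 := fun x => by positivity
  have hDc : Continuous fun x => fderiv ℝ f x u :=
    (hf.continuous_fderiv one_ne_zero).clm_apply continuous_const
  have hXc := X.continuous
  have hdenc : Continuous fun x => 1 + ε * X x ^ 2 := by fun_prop
  have hψc : Continuous fun x => X x / (1 + ε * X x ^ 2) :=
    hXc.div hdenc fun x => (hden x).ne'
  have hψ'c : Continuous fun x => (1 - ε * X x ^ 2) / (1 + ε * X x ^ 2) ^ 2 :=
    (by fun_prop : Continuous fun x => 1 - ε * X x ^ 2).div (hdenc.pow 2)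
      fun x => (pow_pos (hden x) 2).ne'
  have hQc : Continuous fun x => X x ^ 2 / (1 + ε * X x ^ 2) :=
    (hXc.pow 2).div hdenc fun x => (hden x).ne'
  have hψ_sq_le : ∀ x, (X x / (1 + ε * X x ^ 2)) ^ 2 ≤ X x ^ 2 / (1 + ε * X x ^ 2) := by
    intro x
    rw [div_pow]
    refine div_le_div_of_nonneg_left (sq_nonneg _) (hden x) ?_
    nlinarith [show 0 ≤ ε * X x ^ 2 by positivity]
  have hQ_nonneg : ∀ x, 0 ≤ X x ^ 2 / (1 + ε * X x ^ 2) := fun x => by positivity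
  have hQ_le : ∀ x, X x ^ 2 / (1 + ε * X x ^ 2) ≤ 1 / ε := by
    intro x
    rw [div_le_div_iff₀ (hden x) hε]
    linarith
  have hψ_le : ∀ x, ‖X x / (1 + ε * X x ^ 2)‖ ≤ 1 + 1 / ε := by
    intro x
    rw [Real.norm_eq_abs]
    nlinarith [sq_abs (X x / (1 + ε * X x ^ 2)), hψ_sq_le x, hQ_le x,
      sq_nonneg (|X x / (1 + ε * X x ^ 2)| - 1), abs_nonneg (X x / (1 + ε * X x ^ 2))]
  have hψ'_le : ∀ x, (1 - ε * X x ^ 2) / (1 + ε * X x ^ 2) ^ 2 ≤ 1 := by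
    intro x
    rw [div_le_one (by have := hden x; positivity)]
    nlinarith [show 0 ≤ ε * X x ^ 2 by positivity]
  have hψ'_norm_le : ∀ x, ‖(1 - ε * X x ^ 2) / (1 + ε * X x ^ 2) ^ 2‖ ≤ 1 := by
    intro x
    rw [Real.norm_eq_abs, abs_le]
    refine ⟨?_, hψ'_le x⟩
    rw [le_div_iff₀ (by have := hden x; positivity)]
    nlinarith [show 0 ≤ ε * X x ^ 2 by positivity]
  have hψ_int : Integrable (fun x => X x / (1 + ε * X x ^ 2) * (f x * ρ x)) μ :=
    hfρ.bdd_mul hψc.aestronglyMeasurable (ae_of_all _ hψ_le)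
  have hψ'_int :
      Integrable (fun x => (1 - ε * X x ^ 2) / (1 + ε * X x ^ 2) ^ 2 * (f x * ρ x)) μ :=
    hfρ.bdd_mul hψ'c.aestronglyMeasurable (ae_of_all _ hψ'_norm_le)
  have hQ_int : Integrable (fun x => X x ^ 2 / (1 + ε * X x ^ 2) * (f x * ρ x)) μ :=
    hfρ.bdd_mul hQc.aestronglyMeasurable
      (ae_of_all _ fun x => by
        rw [Real.norm_of_nonneg (hQ_nonneg x)]; exact hQ_le x)
  have hD_int : Integrable (fun x => fderiv ℝ f x u * ρ x) μ := by
    refine (hDf.add hfρ).mono' (hDc.mul hρc).aestronglyMeasurable (ae_of_all _ fun x => ?_)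
    have hab : |fderiv ℝ f x u| ≤ fderiv ℝ f x u ^ 2 / f x + f x := by
      rw [← sub_le_iff_le_add, le_div_iff₀ (hfpos x)]
      nlinarith [sq_abs (fderiv ℝ f x u), sq_nonneg (|fderiv ℝ f x u| - f x),
        mul_nonneg (abs_nonneg (fderiv ℝ f x u)) (hfpos x).le]
    simpa [abs_mul, abs_of_pos (hρ x), add_mul] using mul_le_mul_of_nonneg_right hab (hρ x).le
  have hψD_int : Integrable (fun x => X x / (1 + ε * X x ^ 2) * (fderiv ℝ f x u * ρ x)) μ :=
    hD_int.bdd_mul hψc.aestronglyMeasurable (ae_of_all _ hψ_le)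
  set H' : E → ℝ := fun x =>
    X u * ((1 - ε * X x ^ 2) / (1 + ε * X x ^ 2) ^ 2 * (f x * ρ x)) +
      X x / (1 + ε * X x ^ 2) * (fderiv ℝ f x u * ρ x) -
      β * (X x ^ 2 / (1 + ε * X x ^ 2) * (f x * ρ x)) with hH'
  have hH'_int : Integrable H' μ :=
    ((hψ'_int.const_mul (X u)).add hψD_int).sub (hQ_int.const_mul β)
  have hH'_deriv : ∀ x,
      HasLineDerivAt ℝ (fun x => X x / (1 + ε * X x ^ 2) * (f x * ρ x)) (H' x) x u := by
    intro x
    have hX : HasDerivAt (fun t : ℝ => X (x + t • u)) (X u) 0 := by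
      simpa [HasLineDerivAt] using (X.hasFDerivAt (x := x)).hasLineDerivAt u
    have hff : HasDerivAt (fun t : ℝ => f (x + t • u)) (fderiv ℝ f x u) 0 :=
      ((hf.differentiable one_ne_zero) x).hasFDerivAt.hasLineDerivAt u
    have hψ : HasDerivAt (fun t : ℝ => X (x + t • u) / (1 + ε * X (x + t • u) ^ 2))
        ((1 - ε * X x ^ 2) / (1 + ε * X x ^ 2) ^ 2 * X u) 0 := by
      refine ((hasDerivAt_div_one_add_mul_sq hε (X (x + (0 : ℝ) • u))).comp (0 : ℝ)
        hX).congr_deriv ?_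
      simp
    refine (hψ.mul (hff.mul (hd x))).congr_deriv ?_
    simp only [zero_smul, add_zero, hH', Pi.mul_apply]
    ring
  have hzero : ∫ x, H' x ∂μ = 0 := integral_eq_zero_of_hasLineDerivAt hψ_int hH'_int hH'_deriv
  have hpt : ∀ x, X x ^ 2 / (1 + ε * X x ^ 2) * (f x * ρ x) ≤
      2 * X u / β * (f x * ρ x) + 1 / β ^ 2 * (fderiv ℝ f x u ^ 2 / f x * ρ x) -
        2 / β * H' x := by
    intro x
    have hfx := hfpos x
    have hρx := hρ x
    have hfρx : 0 < f x * ρ x := mul_pos hfx hρx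
    set ψ := X x / (1 + ε * X x ^ 2)
    set ψ' := (1 - ε * X x ^ 2) / (1 + ε * X x ^ 2) ^ 2
    set Q := X x ^ 2 / (1 + ε * X x ^ 2)
    set D := fderiv ℝ f x u
    have hψ' : ψ' * (X u * (f x * ρ x)) ≤ 1 * (X u * (f x * ρ x)) :=
      mul_le_mul_of_nonneg_right (hψ'_le x) (by positivity)
    have hQ : ψ ^ 2 * (f x * ρ x) ≤ Q * (f x * ρ x) :=
      mul_le_mul_of_nonneg_right (hψ_sq_le x) hfρx.le
    have hsq : 0 ≤ (ψ * f x - D / β) ^ 2 / f x * ρ x := by positivity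
    have hsq_eq : (ψ * f x - D / β) ^ 2 / f x * ρ x =
        ψ ^ 2 * (f x * ρ x) - 2 / β * (ψ * (D * ρ x)) + 1 / β ^ 2 * (D ^ 2 / f x * ρ x) := by
      field_simp
      ring
    have hH'x : 2 / β * H' x =
        2 / β * (X u * (ψ' * (f x * ρ x))) + 2 / β * (ψ * (D * ρ x)) - 2 * (Q * (f x * ρ x)) := by
      have hH'_eq : H' x =
          X u * (ψ' * (f x * ρ x)) + ψ * (D * ρ x) - β * (Q * (f x * ρ x)) := rfl
      have hββ : 2 / β * β = 2 := div_mul_cancel₀ 2 hβ.ne'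
      rw [hH'_eq]
      linear_combination (-(Q * (f x * ρ x))) * hββ
    have hψ'β : 2 / β * (X u * (ψ' * (f x * ρ x))) ≤ 2 * X u / β * (f x * ρ x) := by
      have := mul_le_mul_of_nonneg_left hψ' (show 0 ≤ 2 / β by positivity)
      calc _ = 2 / β * (ψ' * (X u * (f x * ρ x))) := by ring
        _ ≤ _ := this
        _ = _ := by ring
    linarith
  refine ⟨hQ_int, ?_⟩
  have hsum_int : Integrable (fun x => 2 * X u / β * (f x * ρ x) +
      1 / β ^ 2 * (fderiv ℝ f x u ^ 2 / f x * ρ x)) μ :=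
    (hfρ.const_mul _).add (hDf.const_mul _)
  refine (integral_mono hQ_int (hsum_int.sub (hH'_int.const_mul (2 / β))) hpt).trans_eq ?_
  simp only [Pi.sub_apply]
  rw [integral_sub hsum_int (hH'_int.const_mul _), integral_add (hfρ.const_mul _) (hDf.const_mul _), integral_const_mul, integral_const_mul,
    integral_const_mul, hzero]
  ring

/-- If `X` is, up to the factor `-β`, the logarithmic derivative of `ρ` along `u`, then the second
moment of `X` under a probability density `f` with respect to `ρ` is controlled by the Fisher
information of `f` along `u`. -/
lemma lintegral_sq_le_of_hasLineDerivAt {β : ℝ} (hβ : 0 < β) {ρ f : E → ℝ}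
    (hρc : Continuous ρ) (hρ : ∀ x, 0 < ρ x) (X : E →L[ℝ] ℝ) (u : E) (hXu : 0 ≤ X u)
    (hd : ∀ x, HasLineDerivAt ℝ ρ (-β * X x * ρ x) x u)
    (hf : ContDiff ℝ 1 f) (hfpos : ∀ x, 0 < f x)
    (hf1 : ∫⁻ x, ENNReal.ofReal (f x * ρ x) ∂μ = 1) :
    ∫⁻ x, ENNReal.ofReal (X x ^ 2 * (f x * ρ x)) ∂μ ≤
      ENNReal.ofReal (2 * X u / β) + ENNReal.ofReal (1 / β ^ 2) *
        ∫⁻ x, ENNReal.ofReal (fderiv ℝ f x u ^ 2 / f x * ρ x) ∂μ := by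
  have hfc := hf.continuous
  have hDc : Continuous fun x => fderiv ℝ f x u :=
    (hf.continuous_fderiv one_ne_zero).clm_apply continuous_const
  have hDρc : Continuous fun x => fderiv ℝ f x u ^ 2 / f x * ρ x :=
    ((hDc.pow 2).div hfc fun x => (hfpos x).ne').mul hρc
  have hfρ_nonneg : ∀ x, 0 ≤ f x * ρ x := fun x => (mul_pos (hfpos x) (hρ x)).le
  have hDρ_nonneg : ∀ x, 0 ≤ fderiv ℝ f x u ^ 2 / f x * ρ x := fun x =>
    mul_nonneg (div_nonneg (sq_nonneg _) (hfpos x).le) (hρ x).le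
  by_cases htop : ∫⁻ x, ENNReal.ofReal (fderiv ℝ f x u ^ 2 / f x * ρ x) ∂μ = ⊤
  · rw [htop, ENNReal.mul_top (by simpa using hβ.ne')]
    simp
  have hfρ : Integrable (fun x => f x * ρ x) μ :=
    (lintegral_ofReal_ne_top_iff_integrable (hfc.mul hρc).aestronglyMeasurable
      (ae_of_all _ hfρ_nonneg)).1 (by simp [hf1])
  have hDf : Integrable (fun x => fderiv ℝ f x u ^ 2 / f x * ρ x) μ :=
    (lintegral_ofReal_ne_top_iff_integrable hDρc.aestronglyMeasurable
      (ae_of_all _ hDρ_nonneg)).1 htop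
  have hmass : ∫ x, f x * ρ x ∂μ = 1 := by
    rw [integral_eq_lintegral_of_nonneg_ae (ae_of_all _ hfρ_nonneg) hfρ.1, hf1]
    simp
  have htrunc : ∀ n : ℕ,
      ∫⁻ x, ENNReal.ofReal (X x ^ 2 / (1 + 1 / ((n : ℝ) + 1) * X x ^ 2) * (f x * ρ x)) ∂μ ≤
        ENNReal.ofReal (2 * X u / β) + ENNReal.ofReal (1 / β ^ 2) *
          ∫⁻ x, ENNReal.ofReal (fderiv ℝ f x u ^ 2 / f x * ρ x) ∂μ := by
    intro n
    obtain ⟨hint, hle⟩ := integral_truncated_sq_le hβ (Nat.one_div_pos_of_nat (n := n) (α := ℝ))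
      hρc hρ X u hXu hd hf hfpos hfρ hDf
    rw [← ofReal_integral_eq_lintegral_ofReal hint
        (ae_of_all _ fun x => mul_nonneg (by positivity) (hfρ_nonneg x)),
      ← ofReal_integral_eq_lintegral_ofReal hDf (ae_of_all _ hDρ_nonneg),
      ← ENNReal.ofReal_mul (by positivity), ← ENNReal.ofReal_add (by positivity)
        (mul_nonneg (by positivity) (integral_nonneg hDρ_nonneg))]
    rw [hmass, mul_one] at hle
    exact ENNReal.ofReal_le_ofReal hle
  refine le_of_tendsto' (lintegral_tendsto_of_tendsto_of_monotone ?_ ?_ ?_) htrunc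
  · intro n
    refine (ENNReal.continuous_ofReal.comp
      (((X.continuous.pow 2).div ?_ fun x => ?_).mul (hfc.mul hρc))).measurable.aemeasurable
    · fun_prop
    · positivity
  · refine ae_of_all _ fun x n m hnm => ENNReal.ofReal_le_ofReal
      (mul_le_mul_of_nonneg_right ?_ (hfρ_nonneg x))
    refine div_le_div_of_nonneg_left (sq_nonneg _) (by positivity) ?_
    gcongr
  · refine ae_of_all _ fun x => (ENNReal.continuous_ofReal.tendsto _).comp
      (Filter.Tendsto.mul_const _ ?_)
    have hlim : Filter.Tendsto (fun n : ℕ => 1 + 1 / ((n : ℝ) + 1) * X x ^ 2) Filter.atTop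
        (nhds 1) := by
      simpa using (tendsto_one_div_add_atTop_nhds_zero_nat (𝕜 := ℝ)).mul_const (X x ^ 2)
        |>.const_add 1
    have hdiv := (tendsto_const_nhds (x := X x ^ 2)).div hlim one_ne_zero
    rw [div_one] at hdiv
    exact hdiv

end LogDerivativeEstimate

section BlockDifference

/-- The mean difference of a sequence over two adjacent blocks of length `l` is controlled by the
sum of its squared increments. -/
lemma block_difference_sq_le (a : ℕ → ℝ) {N l k : ℕ} (hl : 1 ≤ l) (hlk : l ≤ k) (hkN : k + l ≤ N) :
    (1 / (l : ℝ) * ∑ j ∈ Finset.Icc 1 l, (a (k + l - j) - a (k - j))) ^ 2 ≤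
      l * ∑ m ∈ Finset.range (N - 1), (a (m + 1) - a m) ^ 2 := by
  set S := ∑ m ∈ Finset.range (N - 1), (a (m + 1) - a m) ^ 2
  have hl0 : (0 : ℝ) < l := by exact_mod_cast hl
  have hterm : ∀ j ∈ Finset.Icc 1 l, (a (k + l - j) - a (k - j)) ^ 2 ≤ l * S := by
    intro j hj
    rw [Finset.mem_Icc] at hj
    have htel : a (k + l - j) - a (k - j) =
        ∑ i ∈ Finset.range l, (a (k - j + i + 1) - a (k - j + i)) := by
      have := Finset.sum_range_sub (fun i => a (k - j + i)) l
      simp only [← add_assoc, add_zero] at this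
      rw [this, show k - j + l = k + l - j by omega]
    rw [htel]
    refine sq_sum_le_card_mul_sum_sq.trans ?_
    rw [Finset.card_range]
    refine mul_le_mul_of_nonneg_left ?_ hl0.le
    refine (Finset.sum_map (Finset.range l) (addLeftEmbedding (k - j))
      (fun m => (a (m + 1) - a m) ^ 2)).symm.trans_le ?_
    refine Finset.sum_le_sum_of_subset_of_nonneg ?_ fun _ _ _ => sq_nonneg _
    intro m hm
    simp only [Finset.mem_map, Finset.mem_range, addLeftEmbedding_apply] at hm ⊢
    omega
  have hsum : ∑ j ∈ Finset.Icc 1 l, (a (k + l - j) - a (k - j)) ^ 2 ≤ l * (l * S) := by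
    simpa using Finset.sum_le_sum hterm
  have hcs := sq_sum_le_card_mul_sum_sq (s := Finset.Icc 1 l)
    (f := fun j => a (k + l - j) - a (k - j))
  rw [Nat.card_Icc, Nat.add_sub_cancel] at hcs
  calc _ = 1 / (l : ℝ) ^ 2 * (∑ j ∈ Finset.Icc 1 l, (a (k + l - j) - a (k - j))) ^ 2 := by ring
    _ ≤ 1 / (l : ℝ) ^ 2 * (l * (l * (l * S))) := by gcongr; exact hcs.trans (by gcongr)
    _ = l * S := by field_simp

/-- The unit vector in the direction of the momentum with (0-based) index `n`, and `0` if `n` is out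
of range. -/
noncomputable def momDir (N n : ℕ) : Fin N → ℝ × ℝ :=
  if h : n < N then Pi.single ⟨n, h⟩ ((0 : ℝ), (1 : ℝ)) else 0

/-- The linear functional `x ↦ ∑ i, (u i).2 * (x i).2` pairing the momenta of `x` with those of
`u`. -/
noncomputable def momPairing {N : ℕ} (u : Fin N → ℝ × ℝ) : (Fin N → ℝ × ℝ) →L[ℝ] ℝ :=
  ∑ i, (u i).2 • (ContinuousLinearMap.snd ℝ ℝ ℝ ∘L ContinuousLinearMap.proj i)

lemma momPairing_apply {N : ℕ} (u x : Fin N → ℝ × ℝ) :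
    momPairing u x = ∑ i, (u i).2 * (x i).2 := by
  simp [momPairing]

lemma momPairing_comm {N : ℕ} (u x : Fin N → ℝ × ℝ) : momPairing u x = momPairing x u := by
  simp only [momPairing_apply, mul_comm]

lemma momPairing_momDir {N : ℕ} (x : Fin N → ℝ × ℝ) (n : ℕ) :
    momPairing x (momDir N n) = (coord2 x (n + 1)).2 := by
  rw [momPairing_apply]
  by_cases h : n < N
  · rw [Finset.sum_eq_single ⟨n, h⟩]
    · simp [momDir, coord2, h]
    · intro i _ hi
      simp [momDir, h, Pi.single_eq_of_ne hi]
    · simp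
  · simp [momDir, coord2, h]

/-- The gradient of the difference of the block averages of the momenta. -/
noncomputable def momBlockDir (N l k : ℕ) : Fin N → ℝ × ℝ :=
  (1 / (l : ℝ)) • ∑ j ∈ Finset.Icc 1 l, (momDir N (k + l - j) - momDir N (k - j))

lemma map_momBlockDir {N l k : ℕ} (L : (Fin N → ℝ × ℝ) →L[ℝ] ℝ) :
    L (momBlockDir N l k) =
      1 / (l : ℝ) * ∑ j ∈ Finset.Icc 1 l, (L (momDir N (k + l - j)) - L (momDir N (k - j))) := by
  simp [momBlockDir]

lemma momPairing_momBlockDir {N l k : ℕ} (x : Fin N → ℝ × ℝ) :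
    momPairing (momBlockDir N l k) x = momBlockAvg l (k + l) x - momBlockAvg l k x := by
  rw [momPairing_comm, map_momBlockDir]
  simp only [momPairing_momDir, momBlockAvg, Finset.sum_sub_distrib, mul_sub]

lemma coord2_momDir {N m n : ℕ} (hm : m < N) (hn : n < N) :
    (coord2 (momDir N n) (m + 1)).2 = if m = n then 1 else 0 := by
  by_cases h : m = n
  · subst h
    simp [coord2, momDir, hm]
  · simp [coord2, momDir, hm, hn, h]

lemma momPairing_momBlockDir_momDir {N l k n : ℕ} (hkN : k + l ≤ N) (hn : n < N) :
    momPairing (momBlockDir N l k) (momDir N n) =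
      1 / (l : ℝ) * ∑ j ∈ Finset.Icc 1 l,
        ((if k + l - j = n then 1 else 0) - if k - j = n then 1 else 0) := by
  rw [momPairing_comm, map_momBlockDir]
  congr 1
  refine Finset.sum_congr rfl fun j hj => ?_
  rw [Finset.mem_Icc] at hj
  rw [momPairing_momDir, momPairing_momDir, coord2_momDir (by omega) hn,
    coord2_momDir (by omega) hn]

lemma momPairing_momBlockDir_self {N l k : ℕ} (hl : 1 ≤ l) (hlk : l ≤ k) (hkN : k + l ≤ N) :
    momPairing (momBlockDir N l k) (momBlockDir N l k) = 2 / l := by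
  have hl0 : (l : ℝ) ≠ 0 := by exact_mod_cast (by omega : l ≠ 0)
  rw [map_momBlockDir]
  have hterm : ∀ j ∈ Finset.Icc 1 l,
      momPairing (momBlockDir N l k) (momDir N (k + l - j)) -
        momPairing (momBlockDir N l k) (momDir N (k - j)) = 2 / l := by
    intro j hj
    have hj' := Finset.mem_Icc.1 hj
    rw [momPairing_momBlockDir_momDir hkN (by omega),
      momPairing_momBlockDir_momDir hkN (by omega)]
    have h₁ : ∑ i ∈ Finset.Icc 1 l, ((if k + l - i = k + l - j then (1 : ℝ) else 0) -
        if k - i = k + l - j then 1 else 0) = 1 := by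
      rw [Finset.sum_eq_single_of_mem j hj, if_pos rfl, if_neg (by omega), sub_zero]
      intro i hi hij
      rw [Finset.mem_Icc] at hi
      rw [if_neg (by omega), if_neg (by omega), sub_zero]
    have h₂ : ∑ i ∈ Finset.Icc 1 l, ((if k + l - i = k - j then (1 : ℝ) else 0) -
        if k - i = k - j then 1 else 0) = -1 := by
      rw [Finset.sum_eq_single_of_mem j hj, if_pos rfl, if_neg (by omega), zero_sub]
      intro i hi hij
      rw [Finset.mem_Icc] at hi
      rw [if_neg (by omega), if_neg (by omega), sub_zero]
    rw [h₁, h₂]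
    ring
  rw [Finset.sum_congr rfl hterm]
  simp
  field_simp

lemma momBlockDir_fst {N l k : ℕ} (i : Fin N) : (momBlockDir N l k i).1 = 0 := by
  have h : ∀ n, (momDir N n i).1 = 0 := by
    intro n
    unfold momDir
    split_ifs with hn
    · by_cases hi : i = ⟨n, hn⟩
      · subst hi; simp
      · simp [Pi.single_eq_of_ne hi]
    · simp
  simp [momBlockDir, Prod.fst_sum, h]

end BlockDifference

section GibbsDensity

lemma gibbsDensity2_pos {β : ℝ} (hβ : 0 < β) (V : ℝ → ℝ) (τ : ℝ) (q : ℝ × ℝ) :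
    0 < gibbsDensity2 β V τ q := by
  unfold gibbsDensity2
  positivity

lemma continuous_gibbsDensity2 (β : ℝ) {V : ℝ → ℝ} (hV : Continuous V) (τ : ℝ) :
    Continuous (gibbsDensity2 β V τ) := by
  unfold gibbsDensity2
  fun_prop

lemma hasDerivAt_gibbsDensity2 (β : ℝ) (V : ℝ → ℝ) (τ : ℝ) (q w : ℝ × ℝ) (hw : w.1 = 0) :
    HasDerivAt (fun t : ℝ => gibbsDensity2 β V τ (q + t • w))
      (-β * (w.2 * q.2) * gibbsDensity2 β V τ q) 0 := by
  simp only [gibbsDensity2, Prod.fst_add, Prod.snd_add, Prod.smul_fst, Prod.smul_snd, hw,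
    smul_eq_mul, mul_zero, add_zero]
  have hp : HasDerivAt (fun t : ℝ => q.2 + t * w.2) w.2 0 := by
    simpa using ((hasDerivAt_id' (0 : ℝ)).mul_const w.2).const_add q.2
  have hexp : HasDerivAt (fun t : ℝ => -β * (q.2 + t * w.2) ^ 2 / 2 - β * V q.1 + β * τ * q.1 -
      gibbsG β V τ) (-β * (w.2 * q.2)) 0 := by
    refine (((((hp.pow 2).const_mul (-β)).div_const 2).sub_const _).add_const _
      |>.sub_const _).congr_deriv ?_
    simp
    ring
  refine (hexp.exp.const_mul _).congr_deriv ?_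
  simp
  ring

lemma hasLineDerivAt_prod_gibbsDensity2 (β : ℝ) (V : ℝ → ℝ) (τ : ℝ) {N : ℕ}
    (x u : Fin N → ℝ × ℝ) (hu : ∀ i, (u i).1 = 0) :
    HasLineDerivAt ℝ (fun x : Fin N → ℝ × ℝ => ∏ i, gibbsDensity2 β V τ (x i))
      (-β * momPairing u x * ∏ i, gibbsDensity2 β V τ (x i)) x u := by
  have h := HasDerivAt.fun_finsetProd (u := Finset.univ) (x := (0 : ℝ))
    (f := fun i (t : ℝ) => gibbsDensity2 β V τ (x i + t • u i))
    fun i _ => hasDerivAt_gibbsDensity2 β V τ (x i) (u i) (hu i)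
  refine h.congr_deriv ?_
  rw [momPairing_apply, Finset.mul_sum, Finset.sum_mul]
  refine Finset.sum_congr rfl fun i hi => ?_
  simp only [zero_smul, add_zero, smul_eq_mul]
  rw [← Finset.prod_erase_mul _ _ hi]
  ring

lemma lintegral_gibbsPi2 {β : ℝ} (hβ : 0 < β) {V : ℝ → ℝ} (hV : Continuous V) (τ : ℝ) (N : ℕ)
    {g : (Fin N → ℝ × ℝ) → ℝ} (hg : Continuous g) :
    ∫⁻ x, ENNReal.ofReal (g x) ∂(gibbsPi2 β V τ N) =
      ∫⁻ x, ENNReal.ofReal (g x * ∏ i, gibbsDensity2 β V τ (x i)) := by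
  have hρc : Continuous fun x : Fin N → ℝ × ℝ => ∏ i, gibbsDensity2 β V τ (x i) :=
    continuous_finsetProd _ fun i _ => (continuous_gibbsDensity2 β hV τ).comp (continuous_apply i)
  refine (lintegral_withDensity_eq_lintegral_mul _
    (ENNReal.continuous_ofReal.comp hρc).measurable
    (ENNReal.continuous_ofReal.comp hg).measurable).trans ?_
  refine lintegral_congr fun x => ?_
  rw [Pi.mul_apply, mul_comm, Function.comp_apply, Function.comp_apply, ENNReal.ofReal_mul'
    (Finset.prod_nonneg fun i _ => (gibbsDensity2_pos hβ V τ (x i)).le)]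

lemma lintegral_fderiv_momBlockDir_sq_div_le {β : ℝ} (V : ℝ → ℝ) (τ : ℝ) {N l k : ℕ}
    (hl : 1 ≤ l) (hlk : l ≤ k) (hkN : k + l ≤ N) {f : (Fin N → ℝ × ℝ) → ℝ}
    (hf : ContDiff ℝ 1 f) (hfpos : ∀ x, 0 < f x) :
    ∫⁻ x, ENNReal.ofReal (fderiv ℝ f x (momBlockDir N l k) ^ 2 / f x) ∂(gibbsPi2 β V τ N) ≤
      l * momDirichlet β V τ N f := by
  have hDc : ∀ v, Continuous fun x => fderiv ℝ f x v := fun v =>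
    (hf.continuous_fderiv one_ne_zero).clm_apply continuous_const
  have hdir : ∀ n, ∀ h : n < N,
      (Pi.single (⟨n, h⟩ : Fin N) ((0 : ℝ), (1 : ℝ)) : Fin N → ℝ × ℝ) = momDir N n :=
    fun n h => by simp [momDir, h]
  simp only [momDirichlet, hdir]
  rw [← lintegral_finsetSum]
  · rw [← lintegral_const_mul]
    · refine lintegral_mono fun x => ?_
      have hfx := hfpos x
      rw [← ENNReal.ofReal_sum_of_nonneg fun j _ => div_nonneg (sq_nonneg _) hfx.le,
        ← ENNReal.ofReal_natCast l, ← ENNReal.ofReal_mul (Nat.cast_nonneg l)]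
      refine ENNReal.ofReal_le_ofReal ?_
      rw [← Finset.sum_div, ← mul_div_assoc, map_momBlockDir]
      refine div_le_div_of_nonneg_right ?_ hfx.le
      rw [Fin.sum_univ_eq_sum_range (fun m : ℕ =>
        (fderiv ℝ f x (momDir N (m + 1)) - fderiv ℝ f x (momDir N m)) ^ 2)]
      exact block_difference_sq_le (fun n => fderiv ℝ f x (momDir N n)) hl hlk hkN
    · refine Finset.measurable_fun_sum _ fun j _ => (ENNReal.continuous_ofReal.comp ?_).measurable
      exact (((hDc _).sub (hDc _)).pow 2).div hf.continuous fun x => (hfpos x).ne'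
  · refine fun j _ => (ENNReal.continuous_ofReal.comp ?_).measurable
    exact (((hDc _).sub (hDc _)).pow 2).div hf.continuous fun x => (hfpos x).ne'

end GibbsDensity

/-- one-and-a-half-block estimate, momentum version. There exists a
constant `C`, depending only on `β`, such that for all `1 ≤ l ≤ k ≤ N - l` and every
smooth strictly positive probability density `f` with respect to `λ^N_{β,0,τ₀}`:
`∫ (p̄_{l,k+l} - p̄_{l,k})² f dλ^N ≤ C (1/l + l D(f))`. -/
theorem one_and_half_block_estimate_momentum
    (β : ℝ) (hβ : 0 < β) :
    ∃ C : ℝ, 0 < C ∧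
      ∀ (c₁ c₂ : ℝ), 0 < c₁ → c₁ ≤ c₂ →
      ∀ (V : ℝ → ℝ), ContDiff ℝ 2 V →
        (∀ r : ℝ, c₁ ≤ deriv (deriv V) r ∧ deriv (deriv V) r ≤ c₂) →
      ∀ (τ₀ : ℝ) (N l k : ℕ), 1 ≤ l → l ≤ k → k + l ≤ N →
      ∀ (f : (Fin N → ℝ × ℝ) → ℝ), ContDiff ℝ (⊤ : ℕ∞) f → (∀ x, 0 < f x) →
        (∫⁻ x, ENNReal.ofReal (f x) ∂(gibbsPi2 β V τ₀ N)) = 1 →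
        (∫⁻ x, ENNReal.ofReal
            ((momBlockAvg l (k + l) x - momBlockAvg l k x) ^ 2 * f x)
            ∂(gibbsPi2 β V τ₀ N)) ≤
          ENNReal.ofReal C *
            (ENNReal.ofReal (1 / (l : ℝ)) +
              (l : ℝ≥0∞) * momDirichlet β V τ₀ N f) := by
  refine ⟨4 / β + 1 / β ^ 2, by positivity, ?_⟩
  intro c₁ c₂ _ _ V hV _ τ₀ N l k hl hlk hkN f hf hfpos hf1
  have hl0 : (0 : ℝ) < l := by exact_mod_cast hl
  have hVc := hV.continuous
  have hf' : ContDiff ℝ 1 f := hf.of_le (by exact_mod_cast le_top)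
  have hρc : Continuous fun x : Fin N → ℝ × ℝ => ∏ i, gibbsDensity2 β V τ₀ (x i) :=
    continuous_finsetProd _ fun i _ =>
      (continuous_gibbsDensity2 β hVc τ₀).comp (continuous_apply i)
  have hDc : Continuous fun x => fderiv ℝ f x (momBlockDir N l k) ^ 2 / f x :=
    (((hf'.continuous_fderiv one_ne_zero).clm_apply continuous_const).pow 2).div
      hf.continuous fun x => (hfpos x).ne'
  have hXc : Continuous fun x => momPairing (momBlockDir N l k) x ^ 2 * f x :=
    ((momPairing (momBlockDir N l k)).continuous.pow 2).mul hf.continuous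
  have hself := momPairing_momBlockDir_self hl hlk hkN
  have hD := lintegral_fderiv_momBlockDir_sq_div_le (β := β) V τ₀ hl hlk hkN hf' hfpos
  have key := lintegral_sq_le_of_hasLineDerivAt (μ := volume) hβ hρc
    (fun x => Finset.prod_pos fun i _ => gibbsDensity2_pos hβ V τ₀ (x i))
    (momPairing (momBlockDir N l k)) (momBlockDir N l k) (by rw [hself]; positivity)
    (fun x => hasLineDerivAt_prod_gibbsDensity2 β V τ₀ x _ momBlockDir_fst) hf' hfpos
    (by rw [← lintegral_gibbsPi2 hβ hVc τ₀ N hf.continuous, hf1])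
  simp only [← mul_assoc] at key
  rw [← lintegral_gibbsPi2 hβ hVc τ₀ N hDc, ← lintegral_gibbsPi2 hβ hVc τ₀ N hXc,
    hself] at key
  simp only [momPairing_momBlockDir] at key
  refine key.trans ?_
  rw [mul_add, ← ENNReal.ofReal_mul (by positivity)]
  refine add_le_add (ENNReal.ofReal_le_ofReal ?_) (mul_le_mul' (ENNReal.ofReal_le_ofReal ?_) hD)
  · calc 2 * (2 / (l : ℝ)) / β = 4 / β * (1 / l) := by ring
      _ ≤ (4 / β + 1 / β ^ 2) * (1 / l) := by
        gcongr
        exact le_add_of_nonneg_right (by positivity)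
  · exact le_add_of_nonneg_left (by positivity)
end
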